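/- Let (R, m) be a commutative noetherian local ring and let M be a non-zero finitely generated R-module of Krull dimension d. Let x₁, ..., x_d be a system of parameters of M, let n ≤ d, and let a = (x₁, ..., xₙ). Then dim_R(H^{cd(a,M)}_a(M)) = d − n; in particular, if n < d, then H^{cd(a,M)}_a(M) is not artinian. -/

import Mathlib

open CategoryTheory

/-- The cohomological dimension `cd(a, X) = sup {i | H^i_a(X) ≠ 0}` of an `R`-module `X`
with respect to an ideal `a`. -/
noncomputable def cohDim {R : Type} [CommRing R] (a : Ideal R) (X : ModuleCat R) : ℕ :=
  sSup {i : ℕ | Nontrivial ((localCohomology a i).obj X)}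

/-- The Krull dimension of an `R`-module `Y`, i.e. the Krull dimension of its support in
`Spec R`. -/
noncomputable def moduleDim (R : Type) [CommRing R] (Y : Type) [AddCommGroup Y] [Module R Y] :
    WithBot ℕ∞ :=
  Order.krullDim (Module.support R Y)


namespace LCAux
noncomputable section
open Limits Opposite

variable {R : Type} [CommRing R]

/-- The contravariant Hom functor into `Y`, valued in the opposite category. -/
abbrev FY (Y : ModuleCat.{0} R) : ModuleCat.{0} R ⥤ (ModuleCat.{0} R)ᵒᵖ :=
  ((linearYoneda R (ModuleCat.{0} R)).obj Y).rightOp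

abbrev FYmap {Y Z : ModuleCat.{0} R} (f : Y ⟶ Z) : FY Z ⟶ FY Y :=
  NatTrans.rightOp ((linearYoneda R (ModuleCat.{0} R)).map f)

lemma comp3zero (S : ShortComplex (ModuleCat.{0} R)) {A : ModuleCat.{0} R} (u : A ⟶ S.X₁) :
    (u ≫ S.f) ≫ S.g = 0 := by
  rw [Category.assoc, S.zero, comp_zero]

/-- The short complex of complexes `Hom(P, S)` (in the opposite category). -/
def homSC (S : ShortComplex (ModuleCat.{0} R)) (P : ChainComplex (ModuleCat.{0} R) ℕ) :
    ShortComplex (ChainComplex (ModuleCat.{0} R)ᵒᵖ ℕ) where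
  X₁ := ((FY S.X₃).mapHomologicalComplex _).obj P
  X₂ := ((FY S.X₂).mapHomologicalComplex _).obj P
  X₃ := ((FY S.X₁).mapHomologicalComplex _).obj P
  f := (NatTrans.mapHomologicalComplex (FYmap S.g) _).app P
  g := (NatTrans.mapHomologicalComplex (FYmap S.f) _).app P
  zero := by
    ext i : 1
    apply Quiver.Hom.unop_inj
    ext u : 2
    exact comp3zero S (A := P.X i) u

def homSCmap (S : ShortComplex (ModuleCat.{0} R)) {P Q : ChainComplex (ModuleCat.{0} R) ℕ}
    (φ : P ⟶ Q) : homSC S P ⟶ homSC S Q where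
  τ₁ := ((FY S.X₃).mapHomologicalComplex _).map φ
  τ₂ := ((FY S.X₂).mapHomologicalComplex _).map φ
  τ₃ := ((FY S.X₁).mapHomologicalComplex _).map φ
  comm₁₂ := ((NatTrans.mapHomologicalComplex (FYmap S.g) _).naturality φ)
  comm₂₃ := ((NatTrans.mapHomologicalComplex (FYmap S.f) _).naturality φ)

lemma homSC_shortExact (S : ShortComplex (ModuleCat.{0} R)) (hS : S.ShortExact)
    (P : ChainComplex (ModuleCat.{0} R) ℕ) (hP : ∀ i, Projective (P.X i)) :
    (homSC S P).ShortExact := by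
  apply HomologicalComplex.shortExact_of_degreewise_shortExact
  intro i
  have := hS.mono_f
  have := hS.epi_g
  have := hP i
  let T : ShortComplex (ModuleCat.{0} R) :=
    ShortComplex.mk (((linearYoneda R (ModuleCat.{0} R)).map S.f).app (op (P.X i)))
      (((linearYoneda R (ModuleCat.{0} R)).map S.g).app (op (P.X i))) (by
        ext u : 2
        exact comp3zero S (A := P.X i) u)
  have hT : T.ShortExact := by
    refine { exact := ?_, mono_f := ?_, epi_g := ?_ }
    · rw [ShortComplex.moduleCat_exact_iff]
      intro u hu
      change (u : P.X i ⟶ S.X₂) ≫ S.g = 0 at hu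
      exact ⟨hS.exact.lift u hu, hS.exact.lift_f u hu⟩
    · rw [ModuleCat.mono_iff_injective]
      intro u v huv
      change (u : P.X i ⟶ S.X₁) ≫ S.f = (v : P.X i ⟶ S.X₁) ≫ S.f at huv
      exact (cancel_mono S.f).1 huv
    · rw [ModuleCat.epi_iff_surjective]
      intro u
      exact ⟨Projective.factorThru (u : P.X i ⟶ S.X₃) S.g,
        Projective.factorThru_comp (u : P.X i ⟶ S.X₃) S.g⟩
  exact hT.op

abbrev EX (i : ℕ) (X Y : ModuleCat.{0} R) : ModuleCat.{0} R :=
  ((Ext R (ModuleCat.{0} R) i).obj (op X)).obj Y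

/-- A chosen projective resolution. -/
abbrev PR (X : ModuleCat.{0} R) : ProjectiveResolution X := projectiveResolution X

/-- `Ext` as homology, in the opposite category. -/
def exIso (i : ℕ) (X Y : ModuleCat.{0} R) :
    op (EX i X Y) ≅ (((FY Y).mapHomologicalComplex _).obj (PR X).complex).homology i :=
  (PR X).isoLeftDerivedObj (FY Y) i

lemma exIso_natY (i : ℕ) (X : ModuleCat.{0} R) {Y Z : ModuleCat.{0} R} (f : Y ⟶ Z) :
    (((Ext R (ModuleCat.{0} R) i).obj (op X)).map f).op ≫ (exIso i X Y).hom =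
      (exIso i X Z).hom ≫ HomologicalComplex.homologyMap
        ((NatTrans.mapHomologicalComplex (FYmap f) _).app (PR X).complex) i := by
  have h := (PR X).leftDerived_app_eq (FYmap f) i
  rw [← cancel_mono (exIso i X Y).inv, Category.assoc, Category.assoc, Iso.hom_inv_id,
    Category.comp_id]
  exact h

lemma exIso_natX (i : ℕ) {X X' : ModuleCat.{0} R} (f : X ⟶ X') (Y : ModuleCat.{0} R)
    (φ : (PR X).complex ⟶ (PR X').complex) (comm : φ.f 0 ≫ (PR X').π.f 0 = (PR X).π.f 0 ≫ f) :
    (((Ext R (ModuleCat.{0} R) i).map f.op).app Y).op ≫ (exIso i X' Y).hom =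
      (exIso i X Y).hom ≫ HomologicalComplex.homologyMap
        (((FY Y).mapHomologicalComplex _).map φ) i :=
  ProjectiveResolution.isoLeftDerivedObj_hom_naturality f (PR X) (PR X') φ comm (FY Y) i

abbrev HFY (i : ℕ) (X Y : ModuleCat.{0} R) : (ModuleCat.{0} R)ᵒᵖ :=
  (((FY Y).mapHomologicalComplex _).obj (PR X).complex).homology i

/-- connecting map -/
def homδ (S : ShortComplex (ModuleCat.{0} R)) (hS : S.ShortExact) (i : ℕ) (X : ModuleCat.{0} R) :
    HFY (i+1) X S.X₁ ⟶ HFY i X S.X₃ :=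
  (homSC_shortExact S hS (PR X).complex (PR X).projective).δ (i+1) i (by simp)

abbrev HFYmapX (i : ℕ) {X X' : ModuleCat.{0} R} (φ : (PR X).complex ⟶ (PR X').complex)
    (Y : ModuleCat.{0} R) : HFY i X Y ⟶ HFY i X' Y :=
  HomologicalComplex.homologyMap (((FY Y).mapHomologicalComplex _).map φ) i

lemma homδ_nat (S : ShortComplex (ModuleCat.{0} R)) (hS : S.ShortExact) (i : ℕ)
    {X X' : ModuleCat.{0} R} (φ : (PR X).complex ⟶ (PR X').complex) :
    homδ S hS i X ≫ HFYmapX i φ S.X₃ = HFYmapX (i+1) φ S.X₁ ≫ homδ S hS i X' :=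
  HomologicalComplex.HomologySequence.δ_naturality (homSCmap S φ)
    (homSC_shortExact S hS (PR X).complex (PR X).projective)
    (homSC_shortExact S hS (PR X').complex (PR X').projective) (i+1) i (by simp)

/-- connecting map on Ext -/
def exδ (S : ShortComplex (ModuleCat.{0} R)) (hS : S.ShortExact) (i : ℕ) (X : ModuleCat.{0} R) :
    EX i X S.X₃ ⟶ EX (i+1) X S.X₁ :=
  ((exIso (i+1) X S.X₁).hom ≫ homδ S hS i X ≫ (exIso i X S.X₃).inv).unop

lemma exδ_nat (S : ShortComplex (ModuleCat.{0} R)) (hS : S.ShortExact) (i : ℕ)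
    {X X' : ModuleCat.{0} R} (f : X ⟶ X') :
    exδ S hS i X' ≫ ((Ext R (ModuleCat.{0} R) (i+1)).map f.op).app S.X₁ =
      ((Ext R (ModuleCat.{0} R) i).map f.op).app S.X₃ ≫ exδ S hS i X := by
  let φ := ProjectiveResolution.lift f (PR X) (PR X')
  have comm : φ.f 0 ≫ (PR X').π.f 0 = (PR X).π.f 0 ≫ f :=
    ProjectiveResolution.lift_commutes_zero f (PR X) (PR X')
  apply Quiver.Hom.op_inj
  have h := homδ_nat S hS i φ
  have h1 := exIso_natX i f S.X₃ φ comm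
  have h2 := exIso_natX (i+1) f S.X₁ φ comm
  rw [op_comp, op_comp]
  simp only [exδ, Quiver.Hom.op_unop]
  rw [← Category.assoc, h2]
  rw [← cancel_mono (exIso i X' S.X₃).hom]
  simp only [Category.assoc, Iso.inv_hom_id, Category.comp_id, h1]
  rw [Iso.inv_hom_id_assoc, h]

abbrev EXmap (i : ℕ) (X : ModuleCat.{0} R) {Y Z : ModuleCat.{0} R} (f : Y ⟶ Z) :
    EX i X Y ⟶ EX i X Z := ((Ext R (ModuleCat.{0} R) i).obj (op X)).map f

abbrev HFYmapY (i : ℕ) (X : ModuleCat.{0} R) {Y Z : ModuleCat.{0} R} (f : Y ⟶ Z) :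
    HFY i X Z ⟶ HFY i X Y :=
  HomologicalComplex.homologyMap
        ((NatTrans.mapHomologicalComplex (FYmap f) _).app (PR X).complex) i

lemma exact_transfer {A B C : ModuleCat.{0} R} (f : A ⟶ B) (g : B ⟶ C)
    {A' B' C' : (ModuleCat.{0} R)ᵒᵖ} (f' : B' ⟶ A') (g' : C' ⟶ B') (eA : op A ≅ A')
    (eB : op B ≅ B') (eC : op C ≅ C') (h1 : f.op ≫ eA.hom = eB.hom ≫ f')
    (h2 : g.op ≫ eB.hom = eC.hom ≫ g') (w : g' ≫ f' = 0)
    (hex : (ShortComplex.mk g' f' w).Exact) :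
    Function.Exact f.hom g.hom := by
  have w' : g.op ≫ f.op = 0 := by
    rw [← cancel_mono eA.hom, Category.assoc, h1, ← Category.assoc, h2, Category.assoc, w]
    simp
  have hex' : (ShortComplex.mk g.op f.op w').Exact := by
    refine ShortComplex.exact_of_iso (ShortComplex.isoMk eC eB eA ?_ ?_).symm hex
    · exact h2.symm
    · exact h1.symm
  have := hex'.unop
  rw [ShortComplex.ShortExact.moduleCat_exact_iff_function_exact] at this
  exact this

lemma ex_exact₂ (S : ShortComplex (ModuleCat.{0} R)) (hS : S.ShortExact) (i : ℕ)
    (X : ModuleCat.{0} R) : Function.Exact (EXmap i X S.f).hom (EXmap i X S.g).hom :=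
  exact_transfer _ _ _ _ (exIso i X S.X₁) (exIso i X S.X₂) (exIso i X S.X₃)
    (exIso_natY i X S.f) (exIso_natY i X S.g) _
    ((homSC_shortExact S hS (PR X).complex (PR X).projective).homology_exact₂ i)

lemma ex_exact₃ (S : ShortComplex (ModuleCat.{0} R)) (hS : S.ShortExact) (i : ℕ)
    (X : ModuleCat.{0} R) : Function.Exact (EXmap i X S.g).hom (exδ S hS i X).hom :=
  exact_transfer _ _ _ (homδ S hS i X) (exIso i X S.X₂) (exIso i X S.X₃) (exIso (i+1) X S.X₁)
    (exIso_natY i X S.g) (by simp [exδ]) _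
    ((homSC_shortExact S hS (PR X).complex (PR X).projective).homology_exact₁ (i+1) i (by simp))

lemma ex_exact₁ (S : ShortComplex (ModuleCat.{0} R)) (hS : S.ShortExact) (i : ℕ)
    (X : ModuleCat.{0} R) : Function.Exact (exδ S hS i X).hom (EXmap (i+1) X S.f).hom :=
  exact_transfer _ _ (homδ S hS i X) _ (exIso i X S.X₃) (exIso (i+1) X S.X₁) (exIso (i+1) X S.X₂)
    (by simp [exδ]) (exIso_natY (i+1) X S.f) _
    ((homSC_shortExact S hS (PR X).complex (PR X).projective).homology_exact₃ (i+1) i (by simp))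

end
end LCAux


namespace LCAux
noncomputable section
open Limits Opposite

variable {R : Type} [CommRing R]

instance fyPres (Y : ModuleCat.{0} R) : PreservesFiniteColimits (FY Y) := by
  have : PreservesLimits ((linearYoneda R (ModuleCat.{0} R)).obj Y) := by
    have : PreservesLimits ((linearYoneda R (ModuleCat.{0} R)).obj Y ⋙ forget (ModuleCat.{0} R)) := by
      change PreservesLimits (yoneda.obj Y)
      infer_instance
    exact preservesLimits_of_reflects_of_preserves _ (forget (ModuleCat.{0} R))
  have : PreservesFiniteLimits ((linearYoneda R (ModuleCat.{0} R)).obj Y) := inferInstance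
  exact preservesFiniteColimits_rightOp _

/-- comparison `Ext^0 → Hom`, in the opposite category -/
def e0raw (X Y : ModuleCat.{0} R) : op (EX 0 X Y) ⟶ (FY Y).obj X :=
  (FY Y).fromLeftDerivedZero.app X

instance e0raw_iso (X Y : ModuleCat.{0} R) : IsIso (e0raw X Y) := by
  have : IsIso (FY Y).fromLeftDerivedZero := inferInstance
  unfold e0raw
  exact NatIso.isIso_app_of_isIso _ _

lemma e0raw_natX {X X' : ModuleCat.{0} R} (f : X ⟶ X') (Y : ModuleCat.{0} R) :
    (((Ext R (ModuleCat.{0} R) 0).map f.op).app Y).op ≫ e0raw X' Y =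
      e0raw X Y ≫ (FY Y).map f :=
  (FY Y).fromLeftDerivedZero.naturality f

lemma e0raw_eq (X Y : ModuleCat.{0} R) : e0raw X Y = (exIso 0 X Y).hom ≫
    HomologicalComplex.homologyι _ 0 ≫ (PR X).fromLeftDerivedZero' (FY Y) :=
  (PR X).fromLeftDerivedZero_eq (FY Y)

lemma fld_natY (X : ModuleCat.{0} R) {Y Z : ModuleCat.{0} R} (f : Y ⟶ Z) :
    HomologicalComplex.opcyclesMap ((NatTrans.mapHomologicalComplex (FYmap f) _).app (PR X).complex) 0
      ≫ (PR X).fromLeftDerivedZero' (FY Y) = 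
    (PR X).fromLeftDerivedZero' (FY Z) ≫ (FYmap f).app X := by
  rw [← cancel_epi (HomologicalComplex.pOpcycles _ _), HomologicalComplex.p_opcyclesMap_assoc,
    ProjectiveResolution.pOpcycles_comp_fromLeftDerivedZero',
    ProjectiveResolution.pOpcycles_comp_fromLeftDerivedZero'_assoc]
  exact ((FYmap f).naturality ((PR X).π.f 0)).symm

lemma e0raw_natY (X : ModuleCat.{0} R) {Y Z : ModuleCat.{0} R} (f : Y ⟶ Z) :
    (EXmap 0 X f).op ≫ e0raw X Y = e0raw X Z ≫ (FYmap f).app X := by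
  rw [e0raw_eq, e0raw_eq]
  have h1 := exIso_natY 0 X f
  rw [← Category.assoc, h1, Category.assoc, HomologicalComplex.homologyι_naturality_assoc, fld_natY]
  simp only [Category.assoc]

/-- `Hom → Ext^0`, as a linear equivalence. -/
def e0 (X Y : ModuleCat.{0} R) : (X ⟶ Y) ≃ₗ[R] EX 0 X Y :=
  (asIso (e0raw X Y)).unop.toLinearEquiv

lemma e0_natX {X X' : ModuleCat.{0} R} (f : X ⟶ X') (Y : ModuleCat.{0} R) (u : X' ⟶ Y) :
    (((Ext R (ModuleCat.{0} R) 0).map f.op).app Y).hom (e0 X' Y u) = e0 X Y (f ≫ u) := by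
  have := congrArg Quiver.Hom.unop (e0raw_natX f Y)
  exact congr($(this).hom u)

lemma e0_natY (X : ModuleCat.{0} R) {Y Z : ModuleCat.{0} R} (f : Y ⟶ Z) (u : X ⟶ Y) :
    (EXmap 0 X f).hom (e0 X Y u) = e0 X Z (u ≫ f) := by
  have := congrArg Quiver.Hom.unop (e0raw_natY X f)
  exact congr($(this).hom u)

end
end LCAux


namespace LCAux
noncomputable section
open Limits Opposite

variable {R : Type} [CommRing R]

/-- multiplication by r in the opposite category -/
abbrev sm (r : R) (X : (ModuleCat.{0} R)ᵒᵖ) : X ⟶ X := (r • 𝟙 (unop X)).op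

lemma sm_comm (r : R) {X Y : (ModuleCat.{0} R)ᵒᵖ} (g : X ⟶ Y) : sm r X ≫ g = g ≫ sm r Y := by
  apply Quiver.Hom.unop_inj
  ext
  simp

lemma homologyMap_sm (r : R) (K : ChainComplex (ModuleCat.{0} R)ᵒᵖ ℕ) (φ : K ⟶ K)
    (h : ∀ i, φ.f i = sm r (K.X i)) (i : ℕ) :
    HomologicalComplex.homologyMap φ i = sm r _ := by
  have h1 : HomologicalComplex.cyclesMap φ i = sm r _ := by
    rw [← cancel_mono (HomologicalComplex.iCycles _ _), HomologicalComplex.cyclesMap_i, h, sm_comm]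
  rw [← cancel_epi (HomologicalComplex.homologyπ _ _), HomologicalComplex.homologyπ_naturality, h1,
    sm_comm]

lemma comp_sm {A Y : ModuleCat.{0} R} (r : R) (u : A ⟶ Y) : u ≫ (r • 𝟙 Y) = r • u := by simp

lemma ex_smul (i : ℕ) (X Y : ModuleCat.{0} R) (r : R) (z : EX i X Y) :
    (EXmap i X (r • 𝟙 Y)).hom z = r • z := by
  have h1 := exIso_natY i X (r • 𝟙 Y)
  rw [homologyMap_sm r _ _ (fun j => ?_), ← sm_comm, cancel_mono] at h1
  · have := congrArg Quiver.Hom.unop h1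
    exact congr($(this).hom z)
  · apply Quiver.Hom.unop_inj
    ext u : 2
    exact comp_sm (A := (PR X).complex.X j) r u

lemma ex_inj (i : ℕ) (X Y : ModuleCat.{0} R) [Injective Y] (z : EX (i+1) X Y) : z = 0 := by
  have h0 : (((FY Y).mapHomologicalComplex _).obj (PR X).complex).ExactAt (i+1) := by
    have h1 := (PR X).complex_exactAt_succ i
    rw [HomologicalComplex.exactAt_iff' _ (i+2) (i+1) i (by simp) (by simp)] at h1 ⊢
    have h2 : (((((FY Y).mapHomologicalComplex _).obj (PR X).complex).sc' (i+2) (i+1) i).unop).Exact := by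
      rw [ShortComplex.moduleCat_exact_iff]
      intro u hu
      change (PR X).complex.d (i+2) (i+1) ≫ (u : (PR X).complex.X (i+1) ⟶ Y) = 0 at hu
      exact ⟨h1.descToInjective u hu, h1.comp_descToInjective u hu⟩
    exact h2.op
  have h1 : IsZero (op (EX (i+1) X Y)) := h0.isZero_homology.of_iso (exIso (i+1) X Y)
  have h2 : IsZero (EX (i+1) X Y) := h1.unop
  have := ModuleCat.subsingleton_of_isZero h2
  exact Subsingleton.elim _ _

lemma ex_map_add (i : ℕ) (X : ModuleCat.{0} R) {Y Z : ModuleCat.{0} R} (f : Y ⟶ Z) (a b : EX i X Y) :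
   (EXmap i X f).hom (a + b) = (EXmap i X f).hom a + (EXmap i X f).hom b := map_add _ _ _

end
end LCAux


set_option linter.unusedVariables false
namespace LCAux
noncomputable section
open Limits Opposite

variable {R : Type} [CommRing R]

abbrev LH (a : Ideal R) (i : ℕ) (M : ModuleCat.{0} R) : ModuleCat.{0} R := (localCohomology a i).obj M

abbrev LHmap (a : Ideal R) (i : ℕ) {M N : ModuleCat.{0} R} (f : M ⟶ N) : LH a i M ⟶ LH a i N :=
  (localCohomology a i).map f

abbrev DG (a : Ideal R) (i : ℕ) : (ℕᵒᵖ)ᵒᵖ ⥤ ModuleCat.{0} R ⥤ ModuleCat.{0} R :=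
  localCohomology.diagram (localCohomology.idealPowersDiagram a) i

abbrev QR (a : Ideal R) (t : ℕ) : ModuleCat.{0} R :=
  (localCohomology.ringModIdeals (localCohomology.idealPowersDiagram a)).obj (op t)

abbrev qr (a : Ideal R) {t t' : ℕ} (h : t ≤ t') : QR a t' ⟶ QR a t :=
  (localCohomology.ringModIdeals (localCohomology.idealPowersDiagram a)).map (homOfLE h).op

abbrev ctr (a : Ideal R) (i : ℕ) (M : ModuleCat.{0} R) {t t' : ℕ} (h : t ≤ t') :
    EX i (QR a t) M ⟶ EX i (QR a t') M :=
  ((Ext R (ModuleCat.{0} R) i).map (qr a h).op).app M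

abbrev DGM (a : Ideal R) (i : ℕ) (M : ModuleCat.{0} R) : (ℕᵒᵖ)ᵒᵖ ⥤ ModuleCat.{0} R :=
  DG a i ⋙ (evaluation _ _).obj M

def lcc (a : Ideal R) (i : ℕ) (M : ModuleCat.{0} R) : Cocone (DGM a i M) :=
  ((evaluation _ _).obj M).mapCocone (colimit.cocone (DG a i))

lemma lcc_pt (a : Ideal R) (i : ℕ) (M : ModuleCat.{0} R) : (lcc a i M).pt = LH a i M := rfl

def lccColim (a : Ideal R) (i : ℕ) (M : ModuleCat.{0} R) : IsColimit (lcc a i M) :=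
  isColimitOfPreserves _ (colimit.isColimit (DG a i))

def li (a : Ideal R) (i : ℕ) (M : ModuleCat.{0} R) (t : ℕ) : EX i (QR a t) M ⟶ LH a i M :=
  (lcc a i M).ι.app (op (op t))

lemma li_tr (a : Ideal R) (i : ℕ) (M : ModuleCat.{0} R) {t t' : ℕ} (h : t ≤ t') :
    ctr a i M h ≫ li a i M t' = li a i M t :=
  (lcc a i M).w (Quiver.Hom.op (homOfLE h).op : op (op t) ⟶ op (op t'))

lemma li_nat (a : Ideal R) (i : ℕ) {M N : ModuleCat.{0} R} (f : M ⟶ N) (t : ℕ) :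
    EXmap i (QR a t) f ≫ li a i N t = li a i M t ≫ LHmap a i f :=
  ((colimit.ι (DG a i) (op (op t))).naturality f)

lemma ctr_nat (a : Ideal R) (i : ℕ) {M N : ModuleCat.{0} R} (f : M ⟶ N) {t t' : ℕ} (h : t ≤ t') :
    EXmap i (QR a t) f ≫ ctr a i N h = ctr a i M h ≫ EXmap i (QR a t') f :=
  ((Ext R (ModuleCat.{0} R) i).map (qr a h).op).naturality f

lemma li_surj (a : Ideal R) (i : ℕ) (M : ModuleCat.{0} R) (z : LH a i M) :
    ∃ t w, (li a i M t).hom w = z := by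
  obtain ⟨j, w, hw⟩ := Concrete.isColimit_exists_rep (DGM a i M) (lccColim a i M) z
  exact ⟨j.unop.unop, w, hw⟩

lemma li_zero (a : Ideal R) (i : ℕ) (M : ModuleCat.{0} R) (t : ℕ) (w : EX i (QR a t) M)
    (h : (li a i M t).hom w = 0) : ∃ t', ∃ h : t ≤ t', (ctr a i M h).hom w = 0 := by
  have := Concrete.isColimit_exists_of_rep_eq (DGM a i M) (lccColim a i M) (i := op (op t))
    (j := op (op t)) w 0 (by
      refine Eq.trans h ?_
      exact (map_zero (li a i M t).hom).symm)
  obtain ⟨k, f, g, h⟩ := this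
  refine ⟨k.unop.unop, leOfHom f.unop.unop, ?_⟩
  refine Eq.trans h ?_
  exact map_zero _

lemma lh_hom_ext (a : Ideal R) (i : ℕ) (M : ModuleCat.{0} R) {Z : ModuleCat.{0} R} 
    {f g : LH a i M ⟶ Z} (h : ∀ t, li a i M t ≫ f = li a i M t ≫ g) : f = g :=
  (lccColim a i M).hom_ext (fun j => h j.unop.unop)

lemma lhδ_aux (a : Ideal R) (S : ShortComplex (ModuleCat.{0} R)) (hS : S.ShortExact) (i : ℕ)
    {t t' : ℕ} (h : t ≤ t') : ctr a i S.X₃ h ≫ exδ S hS i (QR a t') ≫ li a (i+1) S.X₁ t' =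
      exδ S hS i (QR a t) ≫ li a (i+1) S.X₁ t := by
  have h1 := exδ_nat S hS i (qr a h)
  rw [← Category.assoc, ← h1, Category.assoc, li_tr a (i+1) S.X₁ h]

def lhδ (a : Ideal R) (S : ShortComplex (ModuleCat.{0} R)) (hS : S.ShortExact) (i : ℕ) :
    LH a i S.X₃ ⟶ LH a (i+1) S.X₁ :=
  (lccColim a i S.X₃).desc
    { pt := LH a (i+1) S.X₁
      ι := { app := fun j => exδ S hS i (QR a j.unop.unop) ≫ li a (i+1) S.X₁ j.unop.unop
             naturality := by
              intro j k f
              refine Eq.trans ?_ (Category.comp_id _).symm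
              exact lhδ_aux a S hS i (leOfHom f.unop.unop) } }

lemma li_δ (a : Ideal R) (S : ShortComplex (ModuleCat.{0} R)) (hS : S.ShortExact) (i : ℕ) (t : ℕ) :
    li a i S.X₃ t ≫ lhδ a S hS i = exδ S hS i (QR a t) ≫ li a (i+1) S.X₁ t :=
  (lccColim a i S.X₃).fac _ (op (op t))

lemma happ {A B C D : ModuleCat.{0} R} {f : A ⟶ B} {g : B ⟶ C} {f' : A ⟶ D} {g' : D ⟶ C} 
    (h : f ≫ g = f' ≫ g') (x : A) : g.hom (f.hom x) = g'.hom (f'.hom x) := congr($(h).hom x)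

/-- abstract passage of exactness to the limit -/
lemma colim_exact (a : Ideal R) (i j k : ℕ) (A B C : ModuleCat.{0} R)
    (f : LH a i A ⟶ LH a j B) (g : LH a j B ⟶ LH a k C)
    (f' : ∀ t, EX i (QR a t) A ⟶ EX j (QR a t) B) (g' : ∀ t, EX j (QR a t) B ⟶ EX k (QR a t) C)
    (hf : ∀ t, li a i A t ≫ f = f' t ≫ li a j B t)
    (hg : ∀ t, li a j B t ≫ g = g' t ≫ li a k C t)
    (hg' : ∀ t t' (h : t ≤ t'), g' t ≫ ctr a k C h = ctr a j B h ≫ g' t')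
    (he : ∀ t, Function.Exact (f' t).hom (g' t).hom) : Function.Exact f.hom g.hom := by
  intro z
  constructor
  · intro hz
    obtain ⟨t, w, rfl⟩ := li_surj a j B z
    rw [happ (hg t)] at hz
    obtain ⟨t', h, h0⟩ := li_zero _ _ _ _ _ hz
    rw [happ (hg' t t' h)] at h0
    obtain ⟨v, hv⟩ := (he t' _).1 h0
    refine ⟨(li a i A t').hom v, ?_⟩
    rw [happ (hf t'), hv]
    exact congr($(li_tr a j B h).hom w)
  · rintro ⟨y, rfl⟩
    obtain ⟨t, w, rfl⟩ := li_surj a i A y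
    rw [happ (hf t), happ (hg t), (he t).apply_apply_eq_zero]
    exact map_zero _

lemma lh_exact₂ (a : Ideal R) (S : ShortComplex (ModuleCat.{0} R)) (hS : S.ShortExact) (i : ℕ) :
    Function.Exact (LHmap a i S.f).hom (LHmap a i S.g).hom :=
  colim_exact a i i i _ _ _ _ _ (fun t => EXmap i (QR a t) S.f) (fun t => EXmap i (QR a t) S.g)
    (fun t => (li_nat a i S.f t).symm) (fun t => (li_nat a i S.g t).symm)
    (fun t t' h => ctr_nat a i S.g h) (fun t => ex_exact₂ S hS i _)

lemma lh_exact₃ (a : Ideal R) (S : ShortComplex (ModuleCat.{0} R)) (hS : S.ShortExact) (i : ℕ) :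
    Function.Exact (LHmap a i S.g).hom (lhδ a S hS i).hom :=
  colim_exact a i i (i+1) _ _ _ _ _ (fun t => EXmap i (QR a t) S.g) (fun t => exδ S hS i (QR a t))
    (fun t => (li_nat a i S.g t).symm) (fun t => li_δ a S hS i t)
    (fun t t' h => exδ_nat S hS i (qr a h)) (fun t => ex_exact₃ S hS i _)

lemma lh_exact₁ (a : Ideal R) (S : ShortComplex (ModuleCat.{0} R)) (hS : S.ShortExact) (i : ℕ) :
    Function.Exact (lhδ a S hS i).hom (LHmap a (i+1) S.f).hom :=
  colim_exact a i (i+1) (i+1) _ _ _ _ _ (fun t => exδ S hS i (QR a t)) (fun t => EXmap (i+1) (QR a t) S.f)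
    (fun t => li_δ a S hS i t) (fun t => (li_nat a (i+1) S.f t).symm) 
    (fun t t' h => ctr_nat a (i+1) S.f h) (fun t => ex_exact₁ S hS i _)

lemma lh_inj (a : Ideal R) (i : ℕ) (I : ModuleCat.{0} R) [Injective I] (z : LH a (i+1) I) : z = 0 := by
  obtain ⟨t, w, rfl⟩ := li_surj a (i+1) I z
  rw [ex_inj i _ I w]
  exact map_zero _

lemma lh_smul (a : Ideal R) (i : ℕ) (M : ModuleCat.{0} R) (r : R) (z : LH a i M) :
    (LHmap a i (r • 𝟙 M)).hom z = r • z := by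
  obtain ⟨t, w, rfl⟩ := li_surj a i M z
  rw [← happ (li_nat a i (r • 𝟙 M) t), ex_smul]
  exact map_smul _ _ _

def q1 (a : Ideal R) (t : ℕ) : QR a t := (Ideal.Quotient.mk (a ^ t) 1 : R ⧸ a ^ t)

lemma qr_one (a : Ideal R) {t t' : ℕ} (h : t ≤ t') :
    (qr a h).hom (q1 a t') = q1 a t := rfl

lemma q1_gen_aux (b : Ideal R) (r : R) :
    (Ideal.Quotient.mk b r) = r • (Ideal.Quotient.mk b 1) := by
  rw [Algebra.smul_def]
  simp

lemma q1_gen (a : Ideal R) (t : ℕ) (x : QR a t) : ∃ r : R, x = r • q1 a t := by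
  obtain ⟨r, rfl⟩ := Ideal.Quotient.mk_surjective (I := a ^ t) x
  exact ⟨r, q1_gen_aux _ r⟩

lemma q1_ann (a : Ideal R) (t : ℕ) (r : R) (hr : r ∈ a ^ t) : r • q1 a t = 0 :=
  (q1_gen_aux (a ^ t) r).symm.trans (Ideal.Quotient.eq_zero_iff_mem.2 hr)

lemma q1_lift (a : Ideal R) (t : ℕ) (M : ModuleCat.{0} R) (m : M) (h : ∀ r ∈ a ^ t, r • m = 0) :
    ∃ u : QR a t ⟶ M, u.hom (q1 a t) = m := 
  ⟨ModuleCat.ofHom (Submodule.liftQ (a ^ t) (LinearMap.toSpanSingleton R M m)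
      (fun r hr => by rw [LinearMap.mem_ker, LinearMap.toSpanSingleton_apply]; exact h r hr)),
      one_smul R m⟩

lemma QR_ext (a : Ideal R) (t : ℕ) (M : ModuleCat.{0} R) (u v : QR a t ⟶ M)
    (h : u.hom (q1 a t) = v.hom (q1 a t)) : u = v := by
  apply ModuleCat.hom_ext
  apply LinearMap.ext
  intro x
  obtain ⟨r, rfl⟩ := q1_gen a t x
  rw [map_smul, map_smul, h]

def evl (a : Ideal R) (t : ℕ) (M : ModuleCat.{0} R) : EX 0 (QR a t) M ⟶ M :=
  ModuleCat.ofHom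
    { toFun := fun (w : EX 0 (QR a t) M) => ((e0 (QR a t) M).symm w).hom (q1 a t)
      map_add' := fun (x y : EX 0 (QR a t) M) => 
        congrArg (fun u : QR a t ⟶ M => u.hom (q1 a t)) (map_add (e0 (QR a t) M).symm x y)
      map_smul' := fun r (y : EX 0 (QR a t) M) =>
        congrArg (fun u : QR a t ⟶ M => u.hom (q1 a t)) (map_smul (e0 (QR a t) M).symm r y) }

lemma evl_e0 (a : Ideal R) (t : ℕ) (M : ModuleCat.{0} R) (u : QR a t ⟶ M) :
    (evl a t M).hom (e0 _ _ u) = u.hom (q1 a t) := by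
  change ((e0 (QR a t) M).symm (e0 _ _ u)).hom (q1 a t) = _
  rw [LinearEquiv.symm_apply_apply]

lemma evl_ctr (a : Ideal R) {t t' : ℕ} (h : t ≤ t') (M : ModuleCat.{0} R) :
    ctr a 0 M h ≫ evl a t' M = evl a t M := by
  ext w
  obtain ⟨u, rfl⟩ := (e0 (QR a t) M).surjective w
  refine Eq.trans ?_ (evl_e0 a t M u).symm
  refine Eq.trans (congrArg (evl a t' M).hom (e0_natX (qr a h) M u)) ?_
  rw [evl_e0]
  rfl

lemma evl_nat (a : Ideal R) (t : ℕ) {M N : ModuleCat.{0} R} (f : M ⟶ N) :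
    EXmap 0 (QR a t) f ≫ evl a t N = evl a t M ≫ f := by
  ext w
  obtain ⟨u, rfl⟩ := (e0 (QR a t) M).surjective w
  refine Eq.trans ?_ (congrArg f.hom (evl_e0 a t M u).symm)
  refine Eq.trans (congrArg (evl a t N).hom (e0_natY (QR a t) f u)) ?_
  rw [evl_e0]
  rfl

lemma evl_inj (a : Ideal R) (t : ℕ) (M : ModuleCat.{0} R) (w : EX 0 (QR a t) M)
    (h : (evl a t M).hom w = 0) : w = 0 := by
  obtain ⟨u, rfl⟩ := (e0 (QR a t) M).surjective w
  rw [evl_e0] at h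
  rw [QR_ext a t M u 0 (by rw [h]; rfl), map_zero]

def lhz (a : Ideal R) (M : ModuleCat.{0} R) : LH a 0 M ⟶ M :=
  (lccColim a 0 M).desc
    { pt := M
      ι := { app := fun j => evl a j.unop.unop M
             naturality := by
              intro j k f
              refine Eq.trans ?_ (Category.comp_id _).symm
              exact evl_ctr a (leOfHom f.unop.unop) M } }

lemma li_lhz (a : Ideal R) (t : ℕ) (M : ModuleCat.{0} R) : li a 0 M t ≫ lhz a M = evl a t M :=
  (lccColim a 0 M).fac _ (op (op t))

lemma lhz_nat (a : Ideal R) {M N : ModuleCat.{0} R} (f : M ⟶ N) (z : LH a 0 M) :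
    (lhz a N).hom ((LHmap a 0 f).hom z) = f.hom ((lhz a M).hom z) := by
  obtain ⟨t, w, rfl⟩ := li_surj a 0 M z
  rw [← happ (li_nat a 0 f t)]
  refine Eq.trans (congr($(li_lhz a t N).hom ((EXmap 0 (QR a t) f).hom w))) ?_
  refine Eq.trans (happ (evl_nat a t f) w) ?_
  exact congrArg f.hom (congr($(li_lhz a t M).hom w)).symm

lemma lhz_inj (a : Ideal R) (M : ModuleCat.{0} R) : Function.Injective (lhz a M).hom := by
  rw [injective_iff_map_eq_zero]
  intro z hz
  obtain ⟨t, w, rfl⟩ := li_surj a 0 M z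
  rw [evl_inj a t M w ((congr($(li_lhz a t M).hom w)).symm.trans hz)]
  exact map_zero _

lemma lhz_range (a : Ideal R) (M : ModuleCat.{0} R) (m : M) :
    (∃ z, (lhz a M).hom z = m) ↔ ∃ t : ℕ, ∀ r ∈ a ^ t, r • m = 0 := by
  constructor
  · rintro ⟨z, rfl⟩
    obtain ⟨t, w, rfl⟩ := li_surj a 0 M z
    obtain ⟨u, rfl⟩ := (e0 (QR a t) M).surjective w
    refine ⟨t, fun r hr => ?_⟩
    have h1 : (lhz a M).hom ((li a 0 M t).hom (e0 (QR a t) M u)) =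
      u.hom (q1 a t) := 
        (congr($(li_lhz a t M).hom (e0 (QR a t) M u))).trans (evl_e0 a t M u)
    rw [h1]
    rw [← map_smul, q1_ann a t r hr, map_zero]
  · rintro ⟨t, ht⟩
    obtain ⟨u, hu⟩ := q1_lift a t M m ht
    refine ⟨(li a 0 M t).hom (e0 _ _ u), ?_⟩
    exact (congr($(li_lhz a t M).hom (e0 (QR a t) M u))).trans ((evl_e0 a t M u).trans hu)

end
end LCAux


set_option linter.unusedVariables false
namespace LCAux
noncomputable section
open Limits Opposite

variable {R : Type} [CommRing R]

/-- `m` is killed by a power of `a`. -/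
def Tors {M : Type} [AddCommGroup M] [Module R M] (a : Ideal R) (m : M) : Prop :=
  ∃ t : ℕ, ∀ r ∈ a ^ t, r • m = 0

lemma sc_exact {A B C : ModuleCat.{0} R} (f : A ⟶ B) (g : B ⟶ C) (hf : Function.Injective f.hom)
    (hfg : Function.Exact f.hom g.hom) (hg : Function.Surjective g.hom) :
    ∃ w : f ≫ g = 0, (ShortComplex.mk f g w).ShortExact := by
  have w : f ≫ g = 0 := by
    ext x
    exact hfg.apply_apply_eq_zero x
  refine ⟨w, ?_⟩
  refine { exact := ?_, mono_f := ?_, epi_g := ?_ }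
  · rw [ShortComplex.ShortExact.moduleCat_exact_iff_function_exact]
    exact hfg
  · rwa [ModuleCat.mono_iff_injective]
  · rwa [ModuleCat.epi_iff_surjective]

/-- The long exact sequence. -/
lemma les (a : Ideal R) {A B C : ModuleCat.{0} R} (f : A ⟶ B) (g : B ⟶ C)
    (hf : Function.Injective f.hom)
    (hfg : Function.Exact f.hom g.hom) (hg : Function.Surjective g.hom) :
    ∃ δ : ∀ i, LH a i C →ₗ[R] LH a (i+1) A,
      (∀ i, Function.Exact (LHmap a i f).hom (LHmap a i g).hom) ∧
      (∀ i, Function.Exact (LHmap a i g).hom (δ i)) ∧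
      (∀ i, Function.Exact (δ i) (LHmap a (i+1) f).hom) := by
  obtain ⟨w, hS⟩ := sc_exact f g hf hfg hg
  exact ⟨fun i => (lhδ a _ hS i).hom, fun i => lh_exact₂ a _ hS i, fun i => lh_exact₃ a _ hS i,
    fun i => lh_exact₁ a _ hS i⟩

lemma emb (M : ModuleCat.{0} R) : ∃ (I N : ModuleCat.{0} R) (f : M ⟶ I) (g : I ⟶ N),
    Injective I ∧ Function.Injective f.hom ∧ Function.Exact f.hom g.hom ∧
      Function.Surjective g.hom := by
  let f := Injective.ι M
  refine ⟨Injective.under M, ModuleCat.of R ((Injective.under M : ModuleCat.{0} R) ⧸ LinearMap.range f.hom), f,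
    ModuleCat.ofHom (Submodule.mkQ _), inferInstance, ?_, ?_, ?_⟩
  · rw [← ModuleCat.mono_iff_injective]; infer_instance
  · exact LinearMap.exact_map_mkQ_range f.hom
  · exact Submodule.mkQ_surjective _

lemma lhz_tors (a : Ideal R) (M : ModuleCat.{0} R) (z : LH a 0 M) : Tors a ((lhz a M).hom z) :=
  (lhz_range a M _).1 ⟨z, rfl⟩

lemma shift0 (a : Ideal R) {M I N : ModuleCat.{0} R} (f : M ⟶ I) (g : I ⟶ N) (hI : Injective I)
    (hf : Function.Injective f.hom)
    (hfg : Function.Exact f.hom g.hom) (hg : Function.Surjective g.hom) :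
    ∃ D : LH a 0 N →ₗ[R] LH a 1 M, Function.Surjective D ∧
      ∀ w, D w = 0 ↔ ∃ u : I, Tors a u ∧ g.hom u = (lhz a N).hom w := by
  obtain ⟨δ, h2, h3, h1⟩ := les a f g hf hfg hg
  refine ⟨δ 0, fun z => (h1 0 z).1 (lh_inj a 0 I _), fun w => ?_⟩
  rw [h3 0 w]
  constructor
  · rintro ⟨v, rfl⟩
    exact ⟨(lhz a I).hom v, lhz_tors a I v, (lhz_nat a g v).symm⟩
  · rintro ⟨u, hu, hw⟩
    obtain ⟨v, rfl⟩ := (lhz_range a I u).2 hu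
    refine ⟨v, lhz_inj a N ?_⟩
    rw [lhz_nat, hw]

lemma shift1 (a : Ideal R) {M I N : ModuleCat.{0} R} (f : M ⟶ I) (g : I ⟶ N) (hI : Injective I)
    (hf : Function.Injective f.hom)
    (hfg : Function.Exact f.hom g.hom) (hg : Function.Surjective g.hom) (i : ℕ) :
    Nonempty (LH a (i+1) N ≃ₗ[R] LH a (i+2) M) := by
  obtain ⟨δ, h2, h3, h1⟩ := les a f g hf hfg hg
  refine ⟨LinearEquiv.ofBijective (δ (i+1)) ⟨?_, fun z => (h1 (i+1) z).1 (lh_inj a (i+1) I _)⟩⟩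
  rw [injective_iff_map_eq_zero]
  intro z hz
  obtain ⟨v, rfl⟩ := (h3 (i+1) z).1 hz
  rw [lh_inj a i I v, map_zero]

lemma lh_tors (a : Ideal R) (i : ℕ) : ∀ (M : ModuleCat.{0} R) (z : LH a i M), Tors a z := by
  induction i with
  | zero =>
    intro M z
    obtain ⟨t, ht⟩ := lhz_tors a M z
    refine ⟨t, fun r hr => lhz_inj a M ?_⟩
    rw [map_smul, ht r hr, map_zero]
  | succ i ih =>
    intro M z
    obtain ⟨I, N, f, g, hI, hf, hfg, hg⟩ := emb M
    obtain ⟨δ, h2, h3, h1⟩ := les a f g hf hfg hg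
    obtain ⟨w, rfl⟩ := (h1 i z).1 (lh_inj a i I _)
    obtain ⟨t, ht⟩ := ih N w
    exact ⟨t, fun r hr => by rw [← map_smul, ht r hr, map_zero]⟩

lemma KI [IsNoetherianRing R] (I : Type) [AddCommGroup I] [Module R I] (hI : Module.Injective R I)
    (b : Ideal R) (u : I) (hu : ∀ r ∈ b, r • u = 0) (x : R) (t : ℕ) :
    ∃ (j : ℕ) (v : I), (∀ r ∈ b, r • v = 0) ∧ x ^ j • u = x ^ (j + t) • v := by
  let c : ℕ →o Ideal R :=
    { toFun := fun j => Submodule.comap (LinearMap.lsmul R R (x ^ j)) b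
      monotone' := by
        intro j k hjk r hr
        obtain ⟨l, rfl⟩ := Nat.exists_eq_add_of_le hjk
        simp only [Submodule.mem_comap, LinearMap.lsmul_apply, smul_eq_mul] at hr ⊢
        have : x ^ (j + l) * r = x ^ l * (x ^ j * r) := by ring
        rw [this]
        exact b.mul_mem_left _ hr }
  obtain ⟨j, hj⟩ := monotone_stabilizes_iff_noetherian.2 (inferInstance : IsNoetherian R R) c
  have hjt := hj (j + t) (Nat.le_add_right _ _)
  let F : (R ⧸ c (j + t)) →ₗ[R] (R ⧸ b) := Submodule.mapQ (c (j+t)) b (LinearMap.lsmul R R (x ^ (j + t)))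
    le_rfl
  let G : (R ⧸ c (j + t)) →ₗ[R] I := Submodule.liftQ (c (j+t)) (LinearMap.toSpanSingleton R I (x ^ j • u)) (by
    rw [← hjt]
    intro r hr
    rw [LinearMap.mem_ker, LinearMap.toSpanSingleton_apply, ← mul_smul, mul_comm]
    exact hu _ hr)
  have hF : Function.Injective F := by
    rw [← LinearMap.ker_eq_bot, Submodule.ker_mapQ]
    rw [← le_bot_iff, Submodule.map_le_iff_le_comap, Submodule.comap_bot, Submodule.ker_mkQ]
    exact le_rfl
  obtain ⟨h, hh⟩ := hI.out F hF G
  refine ⟨j, h (Submodule.Quotient.mk 1), ?_, ?_⟩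
  · intro r hr
    rw [← map_smul, ← Submodule.Quotient.mk_smul, smul_eq_mul, mul_one,
      (Submodule.Quotient.mk_eq_zero b).2 hr, map_zero]
  · have h1 := hh (Submodule.Quotient.mk 1)
    have h2 : F (Submodule.Quotient.mk 1) = x ^ (j + t) • Submodule.Quotient.mk 1 := by
      rw [← Submodule.Quotient.mk_smul]; rfl
    have h3 : G (Submodule.Quotient.mk 1) = x ^ j • u := by
      exact (Submodule.liftQ_apply _ _ _).trans (by simp)
    rw [h2, h3, map_smul] at h1
    exact h1.symm

lemma tors_mono {M : Type} [AddCommGroup M] [Module R M] {a b : Ideal R} (h : a ≤ b) {m : M}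
    (hm : Tors b m) : Tors a m := by
  obtain ⟨t, ht⟩ := hm
  exact ⟨t, fun r hr => ht r (Ideal.pow_right_mono h t hr)⟩

lemma tors_pow {M : Type} [AddCommGroup M] [Module R M] {a : Ideal R} {x : R} (h : x ∈ a) {m : M}
    (hm : Tors a m) : ∃ t : ℕ, x ^ t • m = 0 := by
  obtain ⟨t, ht⟩ := hm
  exact ⟨t, ht _ (Ideal.pow_mem_pow h t)⟩

lemma tors_sup {M : Type} [AddCommGroup M] [Module R M] {a' : Ideal R} {x : R} {m : M}
    (h : Tors a' m) (t : ℕ) (hx : x ^ t • m = 0) : Tors (a' ⊔ Ideal.span {x}) m := by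
  obtain ⟨s, hs⟩ := h
  refine ⟨s + t, fun r hr => ?_⟩
  have := Ideal.sup_pow_add_le_pow_sup_pow hr
  obtain ⟨p, hp, q, hq, rfl⟩ := Submodule.mem_sup.1 this
  rw [Ideal.span_singleton_pow, Ideal.mem_span_singleton'] at hq
  obtain ⟨c, rfl⟩ := hq
  rw [add_smul, hs p hp, mul_smul, hx, smul_zero, add_zero]

lemma tors_add {M : Type} [AddCommGroup M] [Module R M] {a : Ideal R} {m n : M}
    (h : Tors a m) (h' : Tors a n) : Tors a (m + n) := by
  obtain ⟨s, hs⟩ := h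
  obtain ⟨t, ht⟩ := h'
  refine ⟨s + t, fun r hr => ?_⟩
  rw [smul_add, hs r (Ideal.pow_le_pow_right (Nat.le_add_right _ _) hr),
    ht r (Ideal.pow_le_pow_right (Nat.le_add_left _ _) hr), add_zero]

lemma tors_smul {M : Type} [AddCommGroup M] [Module R M] {a : Ideal R} {m : M} (c : R)
    (h : Tors a m) : Tors a (c • m) := by
  obtain ⟨s, hs⟩ := h
  exact ⟨s, fun r hr => by rw [smul_comm, hs r hr, smul_zero]⟩

lemma tors_map {M N : Type} [AddCommGroup M] [Module R M] [AddCommGroup N] [Module R N]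
    {a : Ideal R} {m : M} (f : M →ₗ[R] N)
    (h : Tors a m) : Tors a (f m) := by
  obtain ⟨s, hs⟩ := h
  exact ⟨s, fun r hr => by rw [← map_smul, hs r hr, map_zero]⟩

lemma tors_of_inj {M N : Type} [AddCommGroup M] [Module R M] [AddCommGroup N] [Module R N]
    {a : Ideal R} {m : M} (f : M →ₗ[R] N) (hf : Function.Injective f)
    (h : Tors a (f m)) : Tors a m := by
  obtain ⟨s, hs⟩ := h
  exact ⟨s, fun r hr => hf (by rw [map_smul, hs r hr, map_zero])⟩

lemma F2S (a' : Ideal R) (x : R) (M : ModuleCat.{0} R) (h0 : ∀ z : LH a' 1 M, z = 0)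
    (z : LH (a' ⊔ Ideal.span {x}) 1 M) :
    ∃ (y : M) (t : ℕ), Tors a' y ∧ ∀ (r : R) (s : ℕ) (v : M), Tors a' v →
      r • x ^ s • y = x ^ (s + t) • v → r • z = 0 := by
  obtain ⟨I, N, f, g, hI, hf, hfg, hg⟩ := emb M
  obtain ⟨D, hD, hD0⟩ := shift0 (a' ⊔ Ideal.span {x}) f g hI hf hfg hg
  obtain ⟨D', hD', hD0'⟩ := shift0 a' f g hI hf hfg hg
  obtain ⟨w, rfl⟩ := hD z
  have hn := lhz_tors _ N w
  obtain ⟨w', hw'⟩ := (lhz_range a' N _).2 (tors_mono le_sup_left hn)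
  obtain ⟨u, hu, hgu⟩ := (hD0' w').1 (h0 _)
  obtain ⟨t, ht⟩ := tors_pow (x := x) (Ideal.mem_sup_right (Ideal.mem_span_singleton_self x)) hn
  rw [hw'] at hgu
  obtain ⟨y, hy⟩ := (hfg (x ^ t • u)).1 (by rw [map_smul, hgu, ht])
  refine ⟨y, t, tors_of_inj f.hom hf (hy ▸ tors_smul _ hu), ?_⟩
  intro r s v hv hrs
  rw [← map_smul, hD0]
  refine ⟨r • u + (-1 : R) • f.hom v, ?_, ?_⟩
  · refine tors_sup (tors_add (tors_smul r hu) (tors_smul _ (tors_map f.hom hv))) (s + t) ?_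
    have h1 := congrArg f.hom hrs
    rw [map_smul, map_smul, map_smul, hy] at h1
    rw [smul_add, smul_comm _ (-1 : R), ← h1, ← mul_smul, ← mul_smul, ← mul_smul, ← mul_smul,
      ← add_smul]
    have : (x ^ (s + t) * r + -1 * (r * (x ^ s * x ^ t))) = 0 := by ring
    rw [← mul_assoc] at this
    simp only [mul_assoc] at this ⊢
    rw [this, zero_smul]
  · rw [map_add, map_smul, map_smul, hfg.apply_apply_eq_zero, hgu, smul_zero, add_zero, map_smul]

lemma F2 [IsNoetherianRing R] (a' : Ideal R) (x : R) (i : ℕ) : ∀ (M : ModuleCat.{0} R)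
    (h0 : ∀ z : LH a' (i+1) M, z = 0)
    (z : LH (a' ⊔ Ideal.span {x}) (i+1) M),
    ∃ (y : LH a' i M), ∀ (s : ℕ) (r : R), r • x ^ s • y = 0 → r • z = 0 := by
  induction i with
  | zero =>
    intro M h0 z
    obtain ⟨y, t, hy, h⟩ := F2S a' x M h0 z
    obtain ⟨w, rfl⟩ := (lhz_range a' M y).2 hy
    refine ⟨w, fun s r hrs => h r s 0 ⟨0, by simp⟩ ?_⟩
    rw [← map_smul, ← map_smul, hrs, map_zero, smul_zero]
  | succ i ih =>
    intro M h0 z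
    obtain ⟨I, N, f, g, hI, hf, hfg, hg⟩ := emb M
    obtain ⟨e⟩ := shift1 (a' ⊔ Ideal.span {x}) f g hI hf hfg hg i
    obtain ⟨e'⟩ := shift1 a' f g hI hf hfg hg i
    obtain ⟨z', rfl⟩ := e.surjective z
    have h0' : ∀ z : LH a' (i+1) N, z = 0 := fun z =>
      e'.injective (by rw [h0 (e' z), map_zero])
    match i with
    | 0 =>
      obtain ⟨D, hD, hD0⟩ := shift0 a' f g hI hf hfg hg
      obtain ⟨y0, t, hy0, h⟩ := F2S a' x N h0' z'
      obtain ⟨w, hw⟩ := (lhz_range a' N y0).2 hy0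
      refine ⟨D w, fun s r hrs => ?_⟩
      rw [← map_smul, ← map_smul, hD0] at hrs
      obtain ⟨u, ⟨k, hk⟩, hgu⟩ := hrs
      obtain ⟨j, v, hv, hj⟩ := KI I (Module.injective_module_of_injective_object R I) (a' ^ k) u hk
        x (s + t)
      have h1 := h r (j + s) (g.hom v) (tors_map g.hom ⟨k, hv⟩) (by
        have := congrArg g.hom hj
        rw [map_smul, map_smul, hgu, map_smul, map_smul, hw] at this
        rw [add_assoc, ← this, smul_comm (x ^ j) r, pow_add, mul_smul])
      rw [← map_smul, h1, map_zero]
    | i + 1 =>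
      obtain ⟨e1⟩ := shift1 a' f g hI hf hfg hg i
      obtain ⟨y, hy⟩ := ih N h0' z'
      refine ⟨e1 y, fun s r hrs => ?_⟩
      rw [← map_smul, hy s r (e1.injective (by rw [map_smul, map_smul, hrs, map_zero])), map_zero]

lemma lh_bot (i : ℕ) : ∀ (M : ModuleCat.{0} R) (z : LH (⊥ : Ideal R) (i+1) M), z = 0 := by
  induction i with
  | zero =>
    intro M z
    obtain ⟨I, N, f, g, hI, hf, hfg, hg⟩ := emb M
    obtain ⟨D, hD, hD0⟩ := shift0 ⊥ f g hI hf hfg hg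
    obtain ⟨w, rfl⟩ := hD z
    rw [hD0]
    obtain ⟨u, hu⟩ := hg ((lhz ⊥ N).hom w)
    exact ⟨u, ⟨1, fun r hr => by
      rw [pow_one, Ideal.mem_bot] at hr
      rw [hr, zero_smul]⟩, hu⟩
  | succ i ih =>
    intro M z
    obtain ⟨I, N, f, g, hI, hf, hfg, hg⟩ := emb M
    obtain ⟨e⟩ := shift1 ⊥ f g hI hf hfg hg i
    obtain ⟨z', rfl⟩ := e.surjective z
    rw [ih N z', map_zero]

lemma ideal_ind [IsNoetherianRing R] {P : Ideal R → Prop} (h0 : P ⊥)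
    (h1 : ∀ a' x, P a' → P (a' ⊔ Ideal.span {x})) (a : Ideal R) : P a := by
  classical
  obtain ⟨s, rfl⟩ : a.FG := IsNoetherian.noetherian a
  induction s using Finset.induction with
  | empty => simpa using h0
  | insert x s hx ih =>
    rw [Finset.coe_insert, Ideal.span_insert, sup_comm]
    exact h1 _ _ ih

/-- torsion modules have no higher local cohomology -/
lemma lh_torsion [IsNoetherianRing R] (M : ModuleCat.{0} R) (a : Ideal R) : (∀ m : M, Tors a m) →
    ∀ (i : ℕ) (z : LH a (i+1) M), z = 0 := by
  induction a using ideal_ind with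
  | h0 => exact fun _ i z => lh_bot i M z
  | h1 a' x ih =>
    intro h i z
    have h' := ih (fun m => tors_mono le_sup_left (h m))
    obtain ⟨y, hy⟩ := F2 a' x i M (h' i) z
    rw [← one_smul R z]
    match i with
    | 0 =>
      obtain ⟨s, hs⟩ := tors_pow (x := x) (Ideal.mem_sup_right (Ideal.mem_span_singleton_self x))
        (h ((lhz a' M).hom y))
      refine hy s 1 ?_
      rw [one_smul]
      apply lhz_inj
      rw [map_smul, hs, map_zero]
    | i + 1 =>
      refine hy 0 1 ?_
      rw [h' i y, smul_zero, smul_zero]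

lemma lh_kill (a : Ideal R) (i : ℕ) (M : ModuleCat.{0} R) (y : R) (h : ∀ m : M, y • m = 0)
    (z : LH a i M) : y • z = 0 := by
  have h1 : y • 𝟙 M = (0 : R) • 𝟙 M := by
    ext m
    refine (h m).trans ?_
    exact (zero_smul R m).symm
  rw [← lh_smul, h1, lh_smul, zero_smul]

/-- adding elements of the annihilator preserves vanishing -/
lemma lh_add_ann [IsNoetherianRing R] (a' : Ideal R) (i : ℕ) (M : ModuleCat.{0} R) (y : R)
    (h : ∀ m : M, y • m = 0) (h0 : ∀ z : LH a' i M, z = 0) 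
    (z : LH (a' ⊔ Ideal.span {y}) i M) : z = 0 := by
  match i with
  | 0 =>
    apply lhz_inj
    obtain ⟨w, hw⟩ := (lhz_range a' M _).2 (tors_mono le_sup_left (lhz_tors _ M z))
    rw [← hw, h0 w, map_zero, map_zero]
  | i + 1 =>
    obtain ⟨w, hw⟩ := F2 a' y i M h0 z
    rw [← one_smul R z]
    refine hw 1 1 ?_
    rw [pow_one, lh_kill a' i M y h, smul_zero]

lemma lh_add_ann' [IsNoetherianRing R] (a' b : Ideal R) (i : ℕ) (M : ModuleCat.{0} R) :
    (∀ y ∈ b, ∀ m : M, y • m = 0) →  (∀ z : LH a' i M, z = 0) →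
    ∀ (z : LH (a' ⊔ b) i M), z = 0 := by
  induction b using ideal_ind with
  | h0 => intro _ h; rwa [sup_bot_eq]
  | h1 b y ih =>
    intro h h0
    rw [← sup_assoc]
    exact lh_add_ann _ i M y (h y (Ideal.mem_sup_right (Ideal.mem_span_singleton_self y)))
      (ih (fun y hy => h y (Ideal.mem_sup_left hy)) h0)

lemma span_fin_succ (x : ℕ → R) (n : ℕ) : Ideal.span (x '' Set.Iio (n + 1)) =
    Ideal.span (x '' Set.Iio n) ⊔ Ideal.span {x n} := by
  have : Set.Iio (n + 1) = insert n (Set.Iio n) := by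
    ext k; simp
  rw [this, Set.image_insert_eq, Ideal.span_insert, sup_comm]

/-- vanishing above the number of generators -/
lemma lh_vanish [IsNoetherianRing R] (x : ℕ → R) (n : ℕ) : ∀ (i : ℕ) (M : ModuleCat.{0} R), n < i →
    ∀ (z : LH (Ideal.span (x '' Set.Iio n)) i M), z = 0 := by
  induction n with
  | zero =>
    intro i M hi z
    obtain ⟨i, rfl⟩ := Nat.exists_eq_add_of_lt hi
    revert z
    have : Ideal.span (x '' Set.Iio 0) = ⊥ := by simp
    rw [this]
    intro z
    exact lh_bot _ M z
  | succ n ih =>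
    intro i M hi
    obtain ⟨i, rfl⟩ : ∃ j, i = j + 1 := ⟨i - 1, by omega⟩
    rw [span_fin_succ]
    intro z
    obtain ⟨w, hw⟩ := F2 _ (x n) i M (ih _ M (by omega)) z
    rw [← one_smul R z]
    refine hw 0 1 ?_
    rw [ih i M (by omega) w, smul_zero, smul_zero]

end
end LCAux


set_option linter.unusedVariables false
namespace LCAux
noncomputable section
open Limits Opposite
open scoped Pointwise

variable {R : Type} [CommRing R]

/-- dimension bound: `dim N < k`. -/
def BD (R : Type) [CommRing R] (N : Type) [AddCommGroup N] [Module R N] (k : ℕ) : Prop :=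
  ∀ p ∈ Module.support R N, Order.coheight p < (k : ℕ∞)

lemma BD_iff (N : Type) [AddCommGroup N] [Module R N] (k : ℕ) :
    BD R N k ↔ Order.krullDim (Module.support R N) < (k : WithBot ℕ∞) := by
  rw [Order.krullDim_lt_coe_iff]
  constructor
  · intro h l
    have h1 := h l.head.1 l.head.2
    let l' : LTSeries (PrimeSpectrum R) := l.map Subtype.val (Subtype.strictMono_coe _)
    have h2 : (l'.length : ℕ∞) ≤ Order.coheight l'.head := Order.length_le_coheight_head
    have h3 : (l.length : ℕ∞) < k := lt_of_le_of_lt h2 h1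
    exact_mod_cast h3
  · intro h p hp
    by_contra hc
    rw [not_lt] at hc
    obtain ⟨l, hl, hlen⟩ := Order.exists_series_of_le_coheight p hc
    let l' : LTSeries (Module.support R N) :=
      { length := l.length
        toFun := fun i => ⟨l i, Module.mem_support_mono (by rw [← hl]; exact l.head_le i) hp⟩
        step := fun i => l.step i }
    have := h l'
    change l.length < k at this
    omega

lemma BD_mono {N N' : Type} [AddCommGroup N] [Module R N] [AddCommGroup N'] [Module R N'] {k : ℕ}
    (h : Module.support R N' ⊆ Module.support R N) (hN : BD R N k) : BD R N' k :=
  fun p hp => hN p (h hp)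

lemma BD_zero {N : Type} [AddCommGroup N] [Module R N] : BD R N 0 ↔ ∀ z : N, z = 0 := by
  constructor
  · intro h z
    have : Module.support R N = ∅ := by
      rw [Set.eq_empty_iff_forall_notMem]
      intro p hp
      simpa using h p hp
    rw [Module.support_eq_empty_iff] at this
    exact Subsingleton.elim _ _
  · intro h p hp
    have : Subsingleton N := ⟨fun a b => by rw [h a, h b]⟩
    rw [Module.support_eq_empty] at hp
    exact hp.elim

lemma Dlem {N N' : Type} [AddCommGroup N] [Module R N] [AddCommGroup N'] [Module R N'] (k : ℕ)
    (x : R) (h1 : ∀ z : N', ∃ y : N, ∀ (s : ℕ) (r : R), r • x ^ s • y = 0 → r • z = 0)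
    (h2 : ∀ z : N', ∃ t : ℕ, x ^ t • z = 0) (h : BD R N (k + 1)) : BD R N' k := by
  intro p hp
  obtain ⟨z, hz⟩ := Module.mem_support_iff_exists_annihilator.1 hp
  obtain ⟨t, ht⟩ := h2 z
  have hxp : x ∈ p.asIdeal := by
    apply p.2.mem_of_pow_mem t
    apply hz
    rw [Submodule.mem_annihilator_span_singleton]
    exact ht
  obtain ⟨y, hy⟩ := h1 z
  let S : Submonoid R := p.asIdeal.primeCompl ⊔ Submonoid.powers x
  have hd : Disjoint ((R ∙ y).annihilator : Set R) (S : Set R) := by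
    rw [Set.disjoint_left]
    intro c hc hcS
    obtain ⟨w, hw, _, ⟨s, rfl⟩, rfl⟩ := Submonoid.mem_sup.1 hcS
    rw [SetLike.mem_coe, Submodule.mem_annihilator_span_singleton, mul_smul] at hc
    apply hw
    apply hz
    rw [Submodule.mem_annihilator_span_singleton]
    exact hy s w hc
  obtain ⟨q, hq, hyq, hqS⟩ := Ideal.exists_le_prime_disjoint _ S hd
  let q' : PrimeSpectrum R := ⟨q, hq⟩
  have hqs : q' ∈ Module.support R N := Module.mem_support_iff_exists_annihilator.2 ⟨y, hyq⟩
  have hqp : q' < p := by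
    refine lt_of_le_of_ne ?_ ?_
    · intro c hc
      by_contra hcp
      exact Set.disjoint_left.1 hqS hc (Submonoid.mem_sup_left hcp)
    · intro he
      have : q = p.asIdeal := congrArg PrimeSpectrum.asIdeal he
      have hxq : x ∈ (q : Set R) := by rw [this]; exact hxp
      exact Set.disjoint_left.1 hqS hxq (Submonoid.mem_sup_right ⟨1, pow_one x⟩)
  have h3 := lt_of_le_of_lt (Order.coheight_add_one_le hqp) (h q' hqs)
  push_cast at h3
  exact lt_of_add_lt_add_right h3

/-- dimension drop for local cohomology -/
lemma lh_drop [IsNoetherianRing R] (a' : Ideal R) (x : R) (i k : ℕ) (M : ModuleCat.{0} R)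
    (h0 : ∀ z : LH a' (i+1) M, z = 0) (h : BD R (LH a' i M) (k + 1)) :
    BD R (LH (a' ⊔ Ideal.span {x}) (i+1) M) k :=
  Dlem k x (F2 a' x i M h0) (fun z => tors_pow
    (Ideal.mem_sup_right (Ideal.mem_span_singleton_self x)) (lh_tors _ _ M z)) h

lemma lh_drop_iter [IsNoetherianRing R] (x : ℕ → R) (M : ModuleCat.{0} R) (n j k : ℕ)
    (h : BD R (LH (Ideal.span (x '' Set.Iio n)) n M) (k + j)) :
    BD R (LH (Ideal.span (x '' Set.Iio (n + j))) (n + j) M) k := by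
  induction j generalizing k with
  | zero => exact h
  | succ j ih =>
    have h1 := ih (k + 1) (by convert h using 1; omega)
    rw [← add_assoc, span_fin_succ]
    exact lh_drop _ _ _ _ M (lh_vanish x (n + j) _ M (Nat.lt_succ_self _)) h1

lemma lh_BD0 (a : Ideal R) (M : ModuleCat.{0} R) (k : ℕ) (h : BD R M k) : BD R (LH a 0 M) k :=
  BD_mono (Module.support_subset_of_injective (lhz a M).hom (lhz_inj a M)) h

lemma les_mul (a : Ideal R) (x : R) (N : Type) [AddCommGroup N] [Module R N]
    (hx : ∀ n : N, x • n = 0 → n = 0) :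
    ∃ (π : ∀ i, LH a i (ModuleCat.of R N) →ₗ[R] LH a i (ModuleCat.of R (QuotSMulTop x N)))
      (δ : ∀ i, LH a i (ModuleCat.of R (QuotSMulTop x N)) →ₗ[R] LH a (i+1) (ModuleCat.of R N)),
      (∀ i z, π i z = 0 ↔ ∃ w, x • w = z) ∧ (∀ i z, δ i z = 0 ↔ ∃ w, π i w = z) ∧
      (∀ i z, x • z = 0 ↔ ∃ w, δ i w = z) := by
  let f : ModuleCat.of R N ⟶ ModuleCat.of R N := x • 𝟙 _
  let g : ModuleCat.of R N ⟶ ModuleCat.of R (QuotSMulTop x N) :=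
    ModuleCat.ofHom (Submodule.mkQ (x • (⊤ : Submodule R N)))
  have hfx : ∀ n : N, f.hom n = x • n := fun n => rfl
  obtain ⟨δ, h2, h3, h1⟩ := les a f g
    ((injective_iff_map_eq_zero _).2 (fun n hn => hx n hn))
    (by
      intro n
      change Submodule.mkQ (x • (⊤ : Submodule R N)) n = 0 ↔ _
      rw [← LinearMap.mem_ker, Submodule.ker_mkQ, Submodule.mem_smul_pointwise_iff_exists]
      constructor
      · rintro ⟨b, _, rfl⟩; exact ⟨b, rfl⟩
      · rintro ⟨b, rfl⟩; exact ⟨b, trivial, rfl⟩)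
    (Submodule.mkQ_surjective _)
  refine ⟨fun i => (LHmap a i g).hom, δ, fun i z => ?_, fun i z => h3 i z, fun i z => ?_⟩
  · rw [h2 i z]
    constructor
    · rintro ⟨w, rfl⟩; exact ⟨w, (lh_smul a i _ x w).symm⟩
    · rintro ⟨w, rfl⟩; exact ⟨w, lh_smul a i _ x w⟩
  · rw [← lh_smul a (i+1) _ x z]
    exact h1 i z

lemma zero_of_tors {H : Type} [AddCommGroup H] [Module R H] (x : R) (h : ∀ z : H, x • z = 0 → z = 0)
    (t : ℕ) (z : H) (hz : x ^ t • z = 0) : z = 0 := by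
  induction t with
  | zero => simpa using hz
  | succ t ih =>
    rw [pow_succ', mul_smul] at hz
    exact ih (h _ hz)

lemma lh_sub (a : Ideal R) (i : ℕ) (N : ModuleCat.{0} R) (h : ∀ n : N, n = 0) (z : LH a i N) :
    z = 0 := by
  rw [← one_smul R z]
  exact lh_kill a i N 1 (fun m => by rw [one_smul, h m]) z

lemma prime_quot_BD (p : PrimeSpectrum R) (N : Type) [AddCommGroup N] [Module R N] [Module.Finite R N]
    (hp : ∀ r ∈ p.asIdeal, ∀ n : N, r • n = 0) (x : R) (hx : x ∉ p.asIdeal) (k : ℕ)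
    (hk : Order.coheight p < ((k + 1 : ℕ) : ℕ∞)) : BD R (QuotSMulTop x N) k := by
  intro q hq
  rw [Module.support_quotSMulTop] at hq
  obtain ⟨hq1, hq2⟩ := hq
  rw [Module.mem_support_iff_of_finite] at hq1
  have hle : p ≤ q := fun r hr => hq1 (Module.mem_annihilator.2 (hp r hr))
  have hlt : p < q := by
    refine lt_of_le_of_ne hle ?_
    rintro rfl
    exact hx (hq2 rfl)
  have h3 := lt_of_le_of_lt (Order.coheight_add_one_le hlt) hk
  push_cast at h3
  exact lt_of_add_lt_add_right h3

lemma quotPrime_facts (p : PrimeSpectrum R) (N : Type) [AddCommGroup N] [Module R N]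
    (e : N ≃ₗ[R] R ⧸ p.asIdeal) : (∀ r ∈ p.asIdeal, ∀ n : N, r • n = 0) ∧
      (∀ r ∉ p.asIdeal, ∀ n : N, r • n = 0 → n = 0) ∧ p ∈ Module.support R N := by
  have hmk : ∀ r s : R, r • Ideal.Quotient.mk p.asIdeal s = Ideal.Quotient.mk p.asIdeal (r * s) :=
    fun r s => rfl
  refine ⟨fun r hr n => e.injective ?_, fun r hr n hn => e.injective ?_, ?_⟩
  · obtain ⟨s, hs⟩ := Ideal.Quotient.mk_surjective (e n)
    rw [map_smul, map_zero, ← hs, hmk, Ideal.Quotient.eq_zero_iff_mem]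
    exact p.asIdeal.mul_mem_right _ hr
  · have := congrArg e hn
    obtain ⟨s, hs⟩ := Ideal.Quotient.mk_surjective (e n)
    rw [map_smul, map_zero, ← hs, hmk, Ideal.Quotient.eq_zero_iff_mem] at this
    rw [map_zero, ← hs, Ideal.Quotient.eq_zero_iff_mem]
    exact (p.2.mem_or_mem this).resolve_left hr
  · rw [Module.mem_support_iff_exists_annihilator]
    refine ⟨e.symm (Ideal.Quotient.mk _ 1), fun r hr => ?_⟩
    rw [Submodule.mem_annihilator_span_singleton, ← map_smul, hmk] at hr
    have := e.symm.injective (hr.trans (map_zero _).symm)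
    rwa [mul_one, Ideal.Quotient.eq_zero_iff_mem] at this

open IsLocalRing

lemma Vlem [IsNoetherianRing R] [IsLocalRing R] (k : ℕ) : ∀ (M : Type) [AddCommGroup M] [Module R M]
    [Module.Finite R M], BD R M k → ∀ i, k ≤ i → 
    ∀ z : LH (maximalIdeal R) i (ModuleCat.of R M), z = 0 := by
  induction k with
  | zero =>
    intro M _ _ _ h i _ z
    exact lh_sub _ i _ (BD_zero.1 h) z
  | succ k ihk =>
    intro M _ _ hM
    refine IsNoetherianRing.induction_on_isQuotientEquivQuotientPrime R hM
      (motive := fun N _ _ _ => BD R N (k+1) → ∀ i, k + 1 ≤ i → 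
        ∀ z : LH (maximalIdeal R) i (ModuleCat.of R N), z = 0) ?_ ?_ ?_
    · intro N _ _ _ _ _ i _ z
      exact lh_sub _ i _ (fun n => Subsingleton.elim _ _) z
    · intro N _ _ _ p e h i hi z
      obtain ⟨i, rfl⟩ : ∃ j, i = j + 1 := ⟨i - 1, by omega⟩
      obtain ⟨f1, f2, f3⟩ := quotPrime_facts p N e
      by_cases hp : p.asIdeal = maximalIdeal R
      · refine lh_torsion _ _ (fun n => ⟨1, fun r hr => ?_⟩) i z
        rw [pow_one, ← hp] at hr
        exact f1 r hr n
      · obtain ⟨x, hx, hxp⟩ := SetLike.exists_of_lt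
          (lt_of_le_of_ne (le_maximalIdeal p.2.ne_top) hp)
        obtain ⟨π, δ, h1, h2, h3⟩ := les_mul (maximalIdeal R) x N (f2 x hxp)
        obtain ⟨t, ht⟩ := tors_pow hx (lh_tors _ _ _ z)
        refine zero_of_tors x (fun z hz => ?_) t z ht
        obtain ⟨w, rfl⟩ := (h3 i z).1 hz
        rw [ihk _ (prime_quot_BD p N f1 x hxp k (h p f3)) i (by omega) w, map_zero]
    · intro N₁ _ _ _ N₂ _ _ _ N₃ _ _ _ f g hf hg hfg ih1 ih3 h i hi z
      obtain ⟨δ, h2, -, -⟩ := les (maximalIdeal R) (ModuleCat.ofHom f) (ModuleCat.ofHom g) hf hfg hg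
      obtain ⟨w, rfl⟩ := (h2 i z).1 
        (ih3 (BD_mono (Module.support_subset_of_surjective g hg) h) i hi _)
      rw [ih1 (BD_mono (Module.support_subset_of_injective f hf) h) i hi w, map_zero]

end
end LCAux


set_option linter.unusedVariables false
namespace LCAux
noncomputable section
open Limits Opposite IsLocalRing
open scoped Pointwise

variable {R : Type} [CommRing R]

lemma stab {H : Type} [AddCommGroup H] [Module R H] (K : Submodule R H) [IsArtinian R K]
    (A : ℕ → Submodule R H) (hA : Antitone A) (hK : ∀ j, A j ≤ K) : ∃ n, ∀ m, n ≤ m → A m = A n := by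
  let f : ℕ →o (Submodule R K)ᵒᵈ :=
    { toFun := fun j => OrderDual.toDual ((A j).comap K.subtype)
      monotone' := fun i j h => Submodule.comap_mono (hA h) }
  obtain ⟨n, hn⟩ := monotone_stabilizes_iff_artinian.2 (inferInstance : IsArtinian R K) f
  refine ⟨n, fun m hm => ?_⟩
  have h : (A n).comap K.subtype = (A m).comap K.subtype := hn m hm
  have h2 := congrArg (Submodule.map K.subtype) h
  rw [Submodule.map_comap_subtype, Submodule.map_comap_subtype, inf_eq_right.2 (hK n),
    inf_eq_right.2 (hK m)] at h2
  exact h2.symm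

lemma melk {H : Type} [AddCommGroup H] [Module R H] (x : R) (hx : ∀ z : H, ∃ t : ℕ, x ^ t • z = 0)
    (K : Submodule R H) (hK : ∀ z, z ∈ K ↔ x • z = 0) [IsArtinian R K] : IsArtinian R H := by
  rw [← monotone_stabilizes_iff_artinian]
  intro N
  let N' : ℕ → Submodule R H := fun j => N j
  have hN' : Antitone N' := fun i j h => N.monotone h
  suffices h : ∃ n, ∀ m, n ≤ m → N' m = N' n by
    obtain ⟨n, hn⟩ := h
    exact ⟨n, fun m hm => (hn m hm).symm⟩
  let A : ℕ → ℕ → Submodule R H := fun j k =>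
    (N' j ⊓ LinearMap.ker (LinearMap.lsmul R H (x ^ (k + 1)))).map (LinearMap.lsmul R H (x ^ k))
  have memA : ∀ j k y, y ∈ A j k ↔ ∃ z ∈ N' j, x ^ (k + 1) • z = 0 ∧ x ^ k • z = y := by
    intro j k y
    simp only [A, Submodule.mem_map, Submodule.mem_inf, LinearMap.mem_ker, LinearMap.lsmul_apply,
      and_assoc]
  have AK : ∀ j k, A j k ≤ K := by
    intro j k y hy
    obtain ⟨z, hz, h1, rfl⟩ := (memA j k y).1 hy
    rw [hK, ← mul_smul, ← pow_succ', h1]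
  have Aj : ∀ k, Antitone (fun j => A j k) := by
    intro k i j hij y hy
    obtain ⟨z, hz, h1, rfl⟩ := (memA j k y).1 hy
    exact (memA i k _).2 ⟨z, hN' hij hz, h1, rfl⟩
  have Ak : ∀ j, Antitone (fun k => A j k) := by
    intro j
    refine antitone_nat_of_succ_le fun k y hy => ?_
    obtain ⟨z, hz, h1, rfl⟩ := (memA j (k+1) y).1 hy
    refine (memA j k _).2 ⟨x • z, (N' j).smul_mem _ hz, ?_, ?_⟩
    · rw [← mul_smul, ← pow_succ, h1]
    · rw [← mul_smul, ← pow_succ]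
  have hdiag : Antitone (fun j => A j j) := fun i j h => (Aj j h).trans (Ak i h)
  obtain ⟨n, hn⟩ := stab K _ hdiag (fun j => AK j j)
  have hcol : ∀ k, ∃ j0, ∀ j, j0 ≤ j → A j k = A j0 k := fun k => stab K _ (Aj k) (fun j => AK j k)
  choose c hc using hcol
  let j0 := max n ((Finset.range n).sup c)
  have key : ∀ j, j0 ≤ j → ∀ k, A j0 k ≤ A j k := by
    intro j hj k
    have hn0 : n ≤ j0 := le_max_left _ _
    rcases lt_or_ge k n with hk | hk
    · have h1 : c k ≤ j0 := (Finset.le_sup (Finset.mem_range.2 hk)).trans (le_max_right _ _)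
      rw [hc k j (h1.trans hj), hc k j0 h1]
    · calc A j0 k ≤ A n k := Aj k hn0
        _ ≤ A n n := Ak n hk
        _ = A (max j k) (max j k) := (hn _ ((hn0.trans hj).trans (le_max_left _ _))).symm
        _ ≤ A j (max j k) := Aj _ (le_max_left _ _)
        _ ≤ A j k := Ak _ (le_max_right _ _)
  refine ⟨j0, fun j hj => le_antisymm (hN' hj) ?_⟩
  have main : ∀ k, ∀ z ∈ N' j0, x ^ k • z = 0 → z ∈ N' j := by
    intro k
    induction k with
    | zero =>
      intro z _ h
      rw [pow_zero, one_smul] at h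
      rw [h]; exact (N' j).zero_mem
    | succ k ih =>
      intro z hz h
      obtain ⟨z', hz', h1, h2⟩ := (memA j k _).1 (key j hj k ((memA j0 k _).2 ⟨z, hz, h, rfl⟩))
      have h3 := ih (z - z') ((N' j0).sub_mem hz (hN' hj hz')) (by rw [smul_sub, h2, sub_self])
      have := (N' j).add_mem h3 hz'
      rwa [sub_add_cancel] at this
  intro z hz
  obtain ⟨t, ht⟩ := hx z
  exact main t z hz ht

lemma art_of_zero {H : Type} [AddCommGroup H] [Module R H] (h : ∀ z : H, z = 0) : IsArtinian R H := by
  have : Subsingleton H := ⟨fun a b => by rw [h a, h b]⟩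
  infer_instance

lemma lh_art [IsNoetherianRing R] [IsLocalRing R] (i : ℕ) : ∀ (M : Type) [AddCommGroup M] [Module R M]
    [Module.Finite R M], IsArtinian R (LH (maximalIdeal R) i (ModuleCat.of R M)) := by
  induction i with
  | zero =>
    intro M _ _ hM
    refine IsNoetherianRing.induction_on_isQuotientEquivQuotientPrime R hM
      (motive := fun N _ _ _ => IsArtinian R (LH (maximalIdeal R) 0 (ModuleCat.of R N))) ?_ ?_ ?_
    · intro N _ _ _ _
      exact art_of_zero (fun z => lh_sub _ _ _ (fun n => Subsingleton.elim _ _) z)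
    · intro N _ _ _ p e
      obtain ⟨f1, f2, f3⟩ := quotPrime_facts p N e
      by_cases hp : p.asIdeal = maximalIdeal R
      · have h1 : IsSimpleModule R (R ⧸ p.asIdeal) := by
          rw [hp, isSimpleModule_iff_isCoatom]
          exact (maximalIdeal.isMaximal R).out
        have h2 : IsArtinian R (R ⧸ p.asIdeal) := inferInstance
        have h3 : IsArtinian R N := e.symm.isArtinian_iff.1 h2
        exact isArtinian_of_injective (lhz _ (ModuleCat.of R N)).hom (lhz_inj _ _)
      · obtain ⟨x, hx, hxp⟩ := SetLike.exists_of_lt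
          (lt_of_le_of_ne (le_maximalIdeal p.2.ne_top) hp)
        refine art_of_zero fun z => ?_
        obtain ⟨t, ht⟩ := tors_pow hx (lh_tors _ _ _ z)
        refine zero_of_tors x (fun z hz => ?_) t z ht
        apply lhz_inj
        rw [map_zero]
        refine f2 x hxp _ ?_
        have := congrArg (lhz _ (ModuleCat.of R N)).hom hz
        rwa [map_smul, map_zero] at this
    · intro N₁ _ _ _ N₂ _ _ _ N₃ _ _ _ f g hf hg hfg ih1 ih3
      obtain ⟨δ, h2, -, -⟩ := les (maximalIdeal R) (ModuleCat.ofHom f) (ModuleCat.ofHom g) hf hfg hg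
      exact isArtinian_of_range_eq_ker _ _ (LinearMap.exact_iff.1 (h2 0)).symm
  | succ i ihi =>
    intro M _ _ hM
    refine IsNoetherianRing.induction_on_isQuotientEquivQuotientPrime R hM
      (motive := fun N _ _ _ => IsArtinian R (LH (maximalIdeal R) (i+1) (ModuleCat.of R N))) ?_ ?_ ?_
    · intro N _ _ _ _
      exact art_of_zero (fun z => lh_sub _ _ _ (fun n => Subsingleton.elim _ _) z)
    · intro N _ _ _ p e
      obtain ⟨f1, f2, f3⟩ := quotPrime_facts p N e
      by_cases hp : p.asIdeal = maximalIdeal R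
      · refine art_of_zero fun z => lh_torsion _ _ (fun n => ⟨1, fun r hr => ?_⟩) i z
        rw [pow_one, ← hp] at hr
        exact f1 r hr n
      · obtain ⟨x, hx, hxp⟩ := SetLike.exists_of_lt
          (lt_of_le_of_ne (le_maximalIdeal p.2.ne_top) hp)
        obtain ⟨π, δ, h1, h2, h3⟩ := les_mul (maximalIdeal R) x N (f2 x hxp)
        have := ihi (QuotSMulTop x N)
        refine melk x (fun z => tors_pow hx (lh_tors _ _ _ z)) (LinearMap.range (δ i)) (fun z => ?_)
        rw [h3 i z]
        rfl
    · intro N₁ _ _ _ N₂ _ _ _ N₃ _ _ _ f g hf hg hfg ih1 ih3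
      obtain ⟨δ, h2, -, -⟩ := les (maximalIdeal R) (ModuleCat.ofHom f) (ModuleCat.ofHom g) hf hfg hg
      exact isArtinian_of_range_eq_ker _ _ (LinearMap.exact_iff.1 (h2 (i+1))).symm

end
end LCAux


set_option linter.unusedVariables false
namespace LCAux
noncomputable section
open Limits Opposite IsLocalRing
open scoped Pointwise

variable {R : Type} [CommRing R]

lemma coheight_max [IsLocalRing R] (q : PrimeSpectrum R) (h : q.asIdeal = maximalIdeal R) :
    Order.coheight q = 0 := by
  rw [Order.coheight_eq_zero]
  intro p hp
  change p.asIdeal ≤ q.asIdeal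
  rw [h]
  exact le_maximalIdeal p.2.ne_top

lemma BD_quot [IsNoetherianRing R] [IsLocalRing R] (Q : Type) [AddCommGroup Q] [Module R Q]
    [Module.Finite R Q] (r : R) (hr : r ∈ maximalIdeal R) (d : ℕ) (h : BD R (QuotSMulTop r Q) d) :
    BD R Q (d + 1) := by
  rw [BD_iff] at h ⊢
  have h1 : Order.krullDim (Module.support R Q) ≤ Order.krullDim (Module.support R (QuotSMulTop r Q)) + 1 :=
    Module.supportDim_le_supportDim_quotSMulTop_succ (M := Q) hr
  refine lt_of_le_of_lt h1 ?_
  generalize Order.krullDim (Module.support R (QuotSMulTop r Q)) = c at h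
  induction c with
  | bot => exact WithBot.bot_lt_coe _
  | coe c =>
    have h2 : c < (d : ℕ∞) := WithBot.coe_lt_coe.1 h
    have h3 : c + 1 < ((d + 1 : ℕ) : ℕ∞) := by
      push_cast
      have hc : c ≠ ⊤ := ne_top_of_lt h2
      lift c to ℕ using hc
      have : c < d := by exact_mod_cast h2
      exact_mod_cast Nat.add_lt_add_right this 1
    exact_mod_cast WithBot.coe_lt_coe.2 h3

/-- existence of a good quotient -/
lemma good_quot [IsNoetherianRing R] (M : Type) [AddCommGroup M] [Module R M]
    [Module.Finite R M] (d : ℕ) (h : ¬ BD R M d) : ∃ N : Submodule R M, ¬ BD R (M ⧸ N) d ∧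
      ∀ K : Submodule R (M ⧸ N), K ≠ ⊥ → BD R ((M ⧸ N) ⧸ K) d := by
  have hwf : WellFoundedGT (Submodule R M) := inferInstance
  obtain ⟨N, hN, hmax⟩ := hwf.wf.has_min {N : Submodule R M | ¬ BD R (M ⧸ N) d} ⟨⊥, fun hb => h
    (BD_mono (Module.support_subset_of_injective (Submodule.mkQ (⊥ : Submodule R M))
      (by rw [← LinearMap.ker_eq_bot, Submodule.ker_mkQ])) hb)⟩
  refine ⟨N, hN, fun K hK => ?_⟩
  by_contra hc
  refine hmax (K.comap N.mkQ) ?_ ?_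
  · intro hb
    refine hc (BD_mono (Module.support_subset_of_surjective
      ((K.comap N.mkQ).liftQ (K.mkQ.comp N.mkQ) ?_) ?_) hb)
    · rw [LinearMap.ker_comp, Submodule.ker_mkQ]
    · rw [← LinearMap.range_eq_top, Submodule.range_liftQ, LinearMap.range_eq_top]
      exact (Submodule.mkQ_surjective K).comp (Submodule.mkQ_surjective N)
  · change N < K.comap N.mkQ
    refine lt_of_le_of_ne ?_ ?_
    · intro n hn
      rw [Submodule.mem_comap, Submodule.mkQ_apply, (Submodule.Quotient.mk_eq_zero N).2 hn]
      exact K.zero_mem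
    · intro he
      apply hK
      have h1 := Submodule.map_comap_eq_of_surjective (Submodule.mkQ_surjective N) K
      rw [← he] at h1
      rw [← h1, ← le_bot_iff, Submodule.map_le_iff_le_comap, Submodule.comap_bot, Submodule.ker_mkQ]

lemma dich (Q : Type) [AddCommGroup Q] [Module R Q] (d : ℕ) (h : ¬ BD R Q d)
    (hmax : ∀ K : Submodule R Q, K ≠ ⊥ → BD R (Q ⧸ K) d) (r : R) :
    (∀ q : Q, r • q = 0) ∨ (∀ q : Q, r • q = 0 → q = 0) := by
  let f : Q →ₗ[R] Q := LinearMap.lsmul R Q r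
  by_cases h1 : LinearMap.range f = ⊥
  · left
    intro q
    rw [LinearMap.range_eq_bot] at h1
    exact congrArg (fun g : Q →ₗ[R] Q => g q) h1
  · by_cases h2 : LinearMap.ker f = ⊥
    · right
      intro q hq
      exact LinearMap.ker_eq_bot'.1 h2 q hq
    · exfalso
      apply h
      intro p hp
      have hs := Module.support_of_exact (f := (LinearMap.range f).subtype)
        (g := (LinearMap.range f).mkQ)
        (by rw [LinearMap.exact_iff, Submodule.ker_mkQ, Submodule.range_subtype])
        (Submodule.subtype_injective _) (Submodule.mkQ_surjective _)
      rw [hs] at hp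
      rcases hp with hp | hp
      · refine hmax _ h2 p ?_
        exact Module.support_subset_of_surjective f.quotKerEquivRange.toLinearMap
          f.quotKerEquivRange.surjective hp
      · exact hmax _ h1 p hp

lemma lh_comp (a : Ideal R) (i : ℕ) {A B C : ModuleCat.{0} R} (f : A ⟶ B) (g : B ⟶ C) (z : LH a i A) :
    (LHmap a i (f ≫ g)).hom z = (LHmap a i g).hom ((LHmap a i f).hom z) := by
  have h : LHmap a i (f ≫ g) = LHmap a i f ≫ LHmap a i g := (localCohomology a i).map_comp f g
  rw [h]; rfl

/-- surjectivity of multiplication in top degree -/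
lemma mul_surj [IsNoetherianRing R] [IsLocalRing R] (L : Type) [AddCommGroup L] [Module R L]
    [Module.Finite R L] (s : R) (d : ℕ) (h1 : BD R L (d + 1)) (h2 : BD R (QuotSMulTop s L) d)
    (z : LH (maximalIdeal R) d (ModuleCat.of R L)) : ∃ w, s • w = z := by
  let f : L →ₗ[R] L := LinearMap.lsmul R L s
  have hr : LinearMap.range f = s • (⊤ : Submodule R L) := by
    ext y
    rw [Submodule.mem_smul_pointwise_iff_exists]
    constructor
    · rintro ⟨b, rfl⟩; exact ⟨b, trivial, rfl⟩
    · rintro ⟨b, _, rfl⟩; exact ⟨b, rfl⟩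
  have h2' : BD R (L ⧸ LinearMap.range f) d := by rw [hr]; exact h2
  obtain ⟨δ, e2, e3, e1⟩ := les (maximalIdeal R) (ModuleCat.ofHom (LinearMap.range f).subtype)
    (ModuleCat.ofHom (LinearMap.range f).mkQ) (Submodule.subtype_injective _)
    (by
      change Function.Exact (LinearMap.range f).subtype (LinearMap.range f).mkQ
      rw [LinearMap.exact_iff, Submodule.ker_mkQ, Submodule.range_subtype])
      (Submodule.mkQ_surjective _)
  obtain ⟨z1, rfl⟩ := (e2 d z).1 (Vlem d _ h2' d le_rfl _)
  obtain ⟨δ', e2', e3', e1'⟩ := les (maximalIdeal R) (ModuleCat.ofHom (LinearMap.ker f).subtype)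
    (ModuleCat.ofHom f.rangeRestrict) (Submodule.subtype_injective _)
    (by
      change Function.Exact (LinearMap.ker f).subtype f.rangeRestrict
      rw [LinearMap.exact_iff, Submodule.range_subtype, LinearMap.ker_rangeRestrict])
      f.surjective_rangeRestrict
  have hK : BD R (LinearMap.ker f) (d + 1) :=
    BD_mono (Module.support_subset_of_injective _ (Submodule.subtype_injective (LinearMap.ker f))) h1
  obtain ⟨w, rfl⟩ := (e3' d z1).1 (Vlem (d+1) _ hK (d+1) le_rfl _)
  refine ⟨w, ?_⟩
  rw [← lh_comp, ← lh_smul]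
  rfl

end
end LCAux


set_option linter.unusedVariables false
namespace LCAux
noncomputable section
open Limits Opposite IsLocalRing
open scoped Pointwise

variable {R : Type} [CommRing R]

lemma inj_BD [IsNoetherianRing R] [IsLocalRing R] (Q : Type) [AddCommGroup Q] [Module R Q]
    (d : ℕ) (h : ¬ BD R Q d)
    (hmax : ∀ K : Submodule R Q, K ≠ ⊥ → BD R (Q ⧸ K) d) (r : R)
    (hr : ∀ q : Q, r • q = 0 → q = 0) : BD R (QuotSMulTop r Q) d := by
  apply hmax
  intro hb
  apply h
  have : ∀ q : Q, q = 0 := by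
    intro q
    apply hr
    have : r • q ∈ r • (⊤ : Submodule R Q) := Submodule.smul_mem_pointwise_smul _ _ _ trivial
    rw [hb] at this
    exact this
  have h0 : BD R Q 0 := BD_zero.2 this
  intro p hp
  exact absurd (h0 p hp) (by simp)

lemma BD_of_kill [IsLocalRing R] (Q : Type) [AddCommGroup Q] [Module R Q] (d : ℕ)
    (h : ∀ r ∈ maximalIdeal R, ∀ q : Q, r • q = 0) : BD R Q (d + 1) := by
  intro p hp
  rw [coheight_max p]
  · exact_mod_cast Nat.succ_pos d
  · apply le_antisymm (le_maximalIdeal p.2.ne_top)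
    intro r hr
    have := Module.annihilator_le_of_mem_support hp
    exact this (Module.mem_annihilator.2 (h r hr))

lemma NVgood0 [IsNoetherianRing R] [IsLocalRing R] (Q : Type) [AddCommGroup Q] [Module R Q]
    [Module.Finite R Q] (h : ¬ BD R Q 0) (hmax : ∀ K : Submodule R Q, K ≠ ⊥ → BD R (Q ⧸ K) 0) :
    ∃ z : LH (maximalIdeal R) 0 (ModuleCat.of R Q), z ≠ 0 := by
  have hk : ∀ r ∈ maximalIdeal R, ∀ q : Q, r • q = 0 := by
    intro r hr
    rcases dich Q 0 h hmax r with h1 | h1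
    · exact h1
    exfalso
    have h2 := BD_zero.1 (inj_BD Q 0 h hmax r h1)
    apply h
    rw [BD_zero]
    have h3 : (⊤ : Submodule R Q) ≤ Ideal.span {r} • (⊤ : Submodule R Q) := by
      intro q _
      rw [Submodule.ideal_span_singleton_smul]
      exact (Submodule.Quotient.mk_eq_zero _).1 (h2 (Submodule.Quotient.mk q))
    have h4 := Submodule.eq_bot_of_le_smul_of_le_jacobson_bot _ _ (Module.Finite.fg_top) h3
      (by
        rw [IsLocalRing.jacobson_eq_maximalIdeal _ bot_ne_top, Ideal.span_singleton_le_iff_mem]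
        exact hr)
    intro z
    have : z ∈ (⊤ : Submodule R Q) := trivial
    rw [h4] at this
    exact this
  have : ∃ q : Q, q ≠ 0 := by
    by_contra hc
    push Not at hc
    exact h (BD_zero.2 hc)
  obtain ⟨q, hq⟩ := this
  obtain ⟨z, hz⟩ := (lhz_range (maximalIdeal R) (ModuleCat.of R Q) q).2
    ⟨1, fun r hr => hk r (by simpa using hr) q⟩
  refine ⟨z, ?_⟩
  rintro rfl
  rw [map_zero] at hz
  exact hq hz.symm

lemma avoid [IsNoetherianRing R] [IsLocalRing R] (Q L : Type) [AddCommGroup Q] [Module R Q]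
    [AddCommGroup L] [Module R L] [Module.Finite R L] (d : ℕ) (hL : BD R L (d + 2))
    (r : R) (hr : r ∈ maximalIdeal R) (q₀ : Q) (hq₀ : r • q₀ ≠ 0) :
    ∃ s ∈ maximalIdeal R, (∃ q : Q, s • q ≠ 0) ∧ BD R (QuotSMulTop s L) (d + 1) := by
  let S : Set (Ideal R) := insert (Module.annihilator R Q)
    {p | p ∈ (Module.annihilator R L).minimalPrimes ∧ p ≠ maximalIdeal R}
  have hS : S.Finite := ((Ideal.finite_minimalPrimes_of_isNoetherianRing R _).subset
    (fun p hp => hp.1)).insert _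
  have h1 := (Ideal.subset_union_prime_finite hS (f := id) (Module.annihilator R Q)
    (Module.annihilator R Q) (by
      rintro i (rfl | hi) h2 h3
      · exact absurd rfl h2
      · exact hi.1.1.1) (I := maximalIdeal R)).not.2 (by
      rintro ⟨i, (rfl | hi), h2⟩
      · exact hq₀ (Module.mem_annihilator.1 (h2 hr) q₀)
      · have : i.IsPrime := hi.1.1.1
        exact hi.2 (le_antisymm (le_maximalIdeal this.ne_top) h2))
  rw [Set.not_subset] at h1
  obtain ⟨s, hs, hns⟩ := h1
  simp only [Set.mem_iUnion, not_exists, id] at hns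
  refine ⟨s, hs, ?_, ?_⟩
  · by_contra hc
    push Not at hc
    exact hns _ (Set.mem_insert _ _) (Module.mem_annihilator.2 hc)
  · intro q hq
    have hq2 : q ∈ Module.support R L :=
      Module.support_subset_of_surjective _ (Submodule.mkQ_surjective _) hq
    have hsq : s ∈ q.asIdeal := by
      refine Module.annihilator_le_of_mem_support hq (Module.mem_annihilator.2 ?_)
      intro m
      obtain ⟨l, rfl⟩ := Submodule.mkQ_surjective _ m
      rw [← map_smul]
      exact (Submodule.Quotient.mk_eq_zero _).2 (Submodule.smul_mem_pointwise_smul _ _ _ trivial)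
    obtain ⟨p, hp, hpq⟩ := Ideal.exists_minimalPrimes_le (Module.annihilator_le_of_mem_support hq2)
    by_cases hpm : p = maximalIdeal R
    · rw [coheight_max q (le_antisymm (le_maximalIdeal q.2.ne_top) (hpm ▸ hpq))]
      exact_mod_cast Nat.succ_pos d
    · let p' : PrimeSpectrum R := ⟨p, hp.1.1⟩
      have hlt : p' < q := by
        rw [lt_iff_le_not_ge]
        refine ⟨hpq, fun hle => ?_⟩
        exact hns p (Set.mem_insert_of_mem _ ⟨hp, hpm⟩) (hle hsq)
      have hp' : p' ∈ Module.support R L := by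
        rw [Module.support_eq_zeroLocus]
        exact hp.1.2
      have h2 := hL p' hp'
      have h3 := Order.coheight_add_one_le hlt
      have h4 := lt_of_le_of_lt h3 h2
      have hc : Order.coheight q ≠ ⊤ := by
        intro hh; rw [hh] at h4; exact absurd h4 (by simp)
      generalize Order.coheight q = c at h4 hc
      lift c to ℕ using hc
      norm_cast at h4 ⊢
      omega

lemma NVgood [IsNoetherianRing R] [IsLocalRing R] (d : ℕ)
    (ih : ∀ (M : Type) [AddCommGroup M] [Module R M] [Module.Finite R M],
      BD R M (d+1) → ¬ BD R M d → ∃ z : LH (maximalIdeal R) d (ModuleCat.of R M), z ≠ 0)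
    (Q : Type) [AddCommGroup Q] [Module R Q]
    [Module.Finite R Q] (h : ¬ BD R Q (d+1))
    (hmax : ∀ K : Submodule R Q, K ≠ ⊥ → BD R (Q ⧸ K) (d+1)) :
    ∃ z : LH (maximalIdeal R) (d+1) (ModuleCat.of R Q), z ≠ 0 := by
  by_contra hv
  push Not at hv
  have key : ∀ r ∈ maximalIdeal R, (∀ q : Q, r • q = 0 → q = 0) →
      ∃ z : LH (maximalIdeal R) d (ModuleCat.of R Q), ∀ w, r • w ≠ z := by
    intro r hr hri
    obtain ⟨π, δ, e1, e2, e3⟩ := les_mul (maximalIdeal R) r Q hri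
    obtain ⟨y, hy⟩ := ih (QuotSMulTop r Q) (inj_BD Q _ h hmax r hri) (fun hb => h (BD_quot Q r hr d hb))
    obtain ⟨z, rfl⟩ := (e2 d y).1 (hv _)
    exact ⟨z, fun w hw => hy ((e1 d z).2 ⟨w, hw⟩)⟩
  have hex : ∃ r ∈ maximalIdeal R, ∀ q : Q, r • q = 0 → q = 0 := by
    by_contra hc
    push Not at hc
    apply h
    apply BD_of_kill
    intro r hr
    rcases dich Q _ h hmax r with h1 | h1
    · exact h1
    · obtain ⟨q, hq, hq0⟩ := hc r hr
      exact absurd (h1 q hq) hq0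
  cases d with
  | zero =>
    obtain ⟨r, hr, hri⟩ := hex
    obtain ⟨z, hz⟩ := key r hr hri
    have hz0 : z = 0 := by
      obtain ⟨t, ht⟩ := tors_pow hr (lh_tors (maximalIdeal R) 0 _ z)
      apply lhz_inj
      rw [map_zero]
      apply zero_of_tors (H := Q) r hri t
      have := congrArg (lhz (maximalIdeal R) (ModuleCat.of R Q)).hom ht
      rw [map_smul, map_zero] at this
      exact this
    exact hz 0 (by rw [hz0, smul_zero])
  | succ d =>
    haveI : IsArtinian R (LH (maximalIdeal R) (d+1) (ModuleCat.of R Q)) := lh_art (d+1) Q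
    let H := LH (maximalIdeal R) (d+1) (ModuleCat.of R Q)
    obtain ⟨_, ⟨r, ⟨hr, hri⟩, rfl⟩, hmin⟩ := IsWellFounded.wf (r := ((· < ·) : Submodule R H → Submodule R H → Prop)) |>.has_min
      ((fun r : R => r • (⊤ : Submodule R H)) '' {r | r ∈ maximalIdeal R ∧ ∀ q : Q, r • q = 0 → q = 0})
      (by obtain ⟨r, hr, hri⟩ := hex; exact ⟨_, r, ⟨hr, hri⟩, rfl⟩)
    have hq₀ : ∃ q : Q, r • q ≠ 0 := by
      by_contra hc
      push Not at hc
      apply h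
      have h0 : BD R Q 0 := BD_zero.2 (fun q => hri q (hc q))
      intro p hp
      exact absurd (h0 p hp) (by simp)
    obtain ⟨q₀, hq₀⟩ := hq₀
    have hL : BD R (QuotSMulTop r Q) (d + 2) := inj_BD Q _ h hmax r hri
    obtain ⟨s, hs, ⟨q₁, hq₁⟩, hsL⟩ := avoid Q (QuotSMulTop r Q) d hL r hr q₀ hq₀
    have hsi : ∀ q : Q, s • q = 0 → q = 0 := by
      rcases dich Q _ h hmax s with h1 | h1
      · exact absurd (h1 q₁) hq₁
      · exact h1
    have hrs : r • (⊤ : Submodule R H) ≤ (s * r) • (⊤ : Submodule R H) := by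
      have hle : (s * r) • (⊤ : Submodule R H) ≤ r • (⊤ : Submodule R H) := by
        intro y hy
        obtain ⟨b, _, rfl⟩ := (Submodule.mem_smul_pointwise_iff_exists _ _ _).1 hy
        exact (Submodule.mem_smul_pointwise_iff_exists _ _ _).2 ⟨s • b, trivial, by rw [smul_smul, mul_comm]⟩
      by_contra hn
      refine hmin _ ⟨s * r, ⟨Ideal.mul_mem_left _ _ hr, ?_⟩, rfl⟩ (lt_of_le_not_ge hle hn)
      intro q hq
      rw [mul_smul] at hq
      exact hri q (hsi _ hq)
    obtain ⟨z, hz⟩ := key s hs hsi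
    obtain ⟨π, δ, e1, e2, e3⟩ := les_mul (maximalIdeal R) r Q hri
    obtain ⟨w, hw⟩ := mul_surj (QuotSMulTop r Q) s (d+1) hL hsL (π (d+1) z)
    obtain ⟨w, rfl⟩ := (e2 (d+1) w).1 (hv _)
    have h5 : π (d+1) (z - s • w) = 0 := by rw [map_sub, map_smul, hw, sub_self]
    obtain ⟨v, hv'⟩ := (e1 (d+1) _).1 h5
    obtain ⟨u, _, hu⟩ := (Submodule.mem_smul_pointwise_iff_exists _ _ _).1
      (hrs ((Submodule.mem_smul_pointwise_iff_exists _ _ _).2 ⟨v, trivial, rfl⟩))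
    refine hz (w + r • u) ?_
    rw [smul_add, smul_smul, hu, hv']
    abel

/-- Grothendieck nonvanishing -/
lemma NV [IsNoetherianRing R] [IsLocalRing R] (d : ℕ) :
    ∀ (M : Type) [AddCommGroup M] [Module R M] [Module.Finite R M],
      BD R M (d+1) → ¬ BD R M d → ∃ z : LH (maximalIdeal R) d (ModuleCat.of R M), z ≠ 0 := by
  induction d with
  | zero =>
    intro M _ _ _ hM hM'
    obtain ⟨N, hN, hmax⟩ := good_quot M _ hM'
    obtain ⟨z, hz⟩ := NVgood0 _ hN hmax
    obtain ⟨δ, e2, e3, e1⟩ := les (maximalIdeal R) (ModuleCat.ofHom N.subtype)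
      (ModuleCat.ofHom N.mkQ) (Submodule.subtype_injective _)
      (by
        change Function.Exact N.subtype N.mkQ
        rw [LinearMap.exact_iff, Submodule.ker_mkQ, Submodule.range_subtype])
      (Submodule.mkQ_surjective _)
    obtain ⟨w, rfl⟩ := (e3 0 z).1 (Vlem 1 N
      (BD_mono (Module.support_subset_of_injective _ (Submodule.subtype_injective N)) hM) 1 le_rfl _)
    exact ⟨w, fun hw => hz (by rw [hw, map_zero])⟩
  | succ d ih =>
    intro M _ _ _ hM hM'
    obtain ⟨N, hN, hmax⟩ := good_quot M _ hM'
    obtain ⟨z, hz⟩ := NVgood d ih _ hN hmax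
    obtain ⟨δ, e2, e3, e1⟩ := les (maximalIdeal R) (ModuleCat.ofHom N.subtype)
      (ModuleCat.ofHom N.mkQ) (Submodule.subtype_injective _)
      (by
        change Function.Exact N.subtype N.mkQ
        rw [LinearMap.exact_iff, Submodule.ker_mkQ, Submodule.range_subtype])
      (Submodule.mkQ_surjective _)
    obtain ⟨w, rfl⟩ := (e3 (d+1) z).1 (Vlem (d+2) N
      (BD_mono (Module.support_subset_of_injective _ (Submodule.subtype_injective N)) hM) (d+2) le_rfl _)
    exact ⟨w, fun hw => hz (by rw [hw, map_zero])⟩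

end
end LCAux


set_option linter.unusedVariables false
namespace LCAux
noncomputable section
open Limits Opposite IsLocalRing
open scoped Pointwise

variable {R : Type} [CommRing R]

lemma art_supp [IsLocalRing R] (N : Type) [AddCommGroup N] [Module R N] [IsArtinian R N]
    (p : PrimeSpectrum R) (hp : p ∈ Module.support R N) : p.asIdeal = maximalIdeal R := by
  apply le_antisymm (le_maximalIdeal p.2.ne_top)
  intro r hr
  obtain ⟨z, hz⟩ := Module.mem_support_iff_exists_annihilator.1 hp
  obtain ⟨k, y, hy⟩ := IsArtinian.exists_pow_succ_smul_dvd r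
    (⟨z, Submodule.mem_span_singleton_self z⟩ : Submodule.span R {z})
  obtain ⟨c, hc⟩ := Submodule.mem_span_singleton.1 y.2
  have h1 := congrArg Subtype.val hy
  simp only [Submodule.coe_smul] at h1
  rw [← hc] at h1
  have h2 : r ^ k * (1 - r * c) ∈ (Submodule.span R {z}).annihilator := by
    rw [Submodule.mem_annihilator_span_singleton, mul_sub, sub_smul, mul_one, sub_eq_zero, ← h1,
      smul_smul]
    congr 1
    rw [Nat.succ_eq_add_one]; ring
  rcases p.2.mem_or_mem (hz h2) with h3 | h3
  · exact p.2.mem_of_pow_mem _ h3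
  · exfalso
    have h4 : (1 : R) ∈ maximalIdeal R := by
      have := (maximalIdeal R).add_mem (le_maximalIdeal p.2.ne_top h3)
        ((maximalIdeal R).mul_mem_right c hr)
      simpa using this
    exact (Ideal.ne_top_iff_one _).1 (maximalIdeal.isMaximal R).ne_top h4

lemma krullDim_eq (N : Type) [AddCommGroup N] [Module R N] (k : ℕ) (h1 : BD R N (k+1))
    (h2 : ¬ BD R N k) : Order.krullDim (Module.support R N) = (k : WithBot ℕ∞) := by
  rw [BD_iff] at h1 h2
  rw [not_lt] at h2
  refine le_antisymm ?_ h2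
  generalize Order.krullDim (Module.support R N) = c at h1
  induction c with
  | bot => exact bot_le
  | coe c =>
    have h3 : c < ((k + 1 : ℕ) : ℕ∞) := WithBot.coe_lt_coe.1 h1
    have hc : c ≠ ⊤ := ne_top_of_lt h3
    lift c to ℕ using hc
    have h4 : c < k + 1 := by exact_mod_cast h3
    exact_mod_cast Nat.lt_succ_iff.1 h4

lemma main [IsNoetherianRing R] [IsLocalRing R]
    (M : ModuleCat.{0} R) [Module.Finite R M]
    (d : ℕ) (hd : Order.krullDim (Module.support R M) = (d : WithBot ℕ∞))
    (x : ℕ → R) (hxm : ∀ i < d, x i ∈ maximalIdeal R)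
    (hsop : IsFiniteLength R (M ⧸ (Ideal.span (x '' Set.Iio d) • (⊤ : Submodule R M))))
    (n : ℕ) (hnd : n ≤ d) :
    BD R (LH (Ideal.span (x '' Set.Iio n)) n M) (d - n + 1) ∧
    ¬ BD R (LH (Ideal.span (x '' Set.Iio n)) n M) (d - n) := by
  have hB : BD R M (d + 1) := by
    rw [BD_iff, hd]; exact_mod_cast Nat.lt_succ_self d
  have hB' : ¬ BD R M d := by
    rw [BD_iff, hd]; exact lt_irrefl _
  have hne : ¬ ∀ z : M, z = 0 := by
    intro hz
    have h0 : BD R M 0 := BD_zero.2 hz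
    refine hB' fun p hp => absurd (h0 p hp) (by simp)
  constructor
  · have h := lh_drop_iter x M 0 n (d - n + 1) (by
      have : d - n + 1 + n = d + 1 := by omega
      rw [this]
      exact lh_BD0 _ _ _ hB)
    rwa [zero_add] at h
  · intro hc
    have h := lh_drop_iter x M n (d - n) 0 (by rwa [zero_add])
    rw [Nat.add_sub_cancel' hnd, BD_zero] at h
    have h2 := lh_add_ann' _ (Module.annihilator R M) d M
      (fun y hy m => Module.mem_annihilator.1 hy m) h
    obtain ⟨z, hz⟩ := NV d M hB hB'
    have hsupp : (Module.support R (M ⧸ (Ideal.span (x '' Set.Iio d) • (⊤ : Submodule R M)))) =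
      _ := Module.support_quotient _
    have hart : IsArtinian R (M ⧸ (Ideal.span (x '' Set.Iio d) • (⊤ : Submodule R M))) :=
      (isFiniteLength_iff_isNoetherian_isArtinian.1 hsop).2
    have hrad : (maximalIdeal R).radical =
        (Ideal.span (x '' Set.Iio d) ⊔ Module.annihilator R M).radical := by
      apply le_antisymm
      · rw [(maximalIdeal.isMaximal R).isPrime.radical]
        intro r hr
        rw [Ideal.radical_eq_sInf, Submodule.mem_sInf]
        rintro P ⟨hP, hPp⟩
        have hmem : (⟨P, hPp⟩ : PrimeSpectrum R) ∈
            Module.support R (M ⧸ (Ideal.span (x '' Set.Iio d) • (⊤ : Submodule R M))) := by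
          rw [hsupp]
          refine ⟨?_, (le_sup_left.trans hP : Ideal.span (x '' Set.Iio d) ≤ P)⟩
          rw [Module.support_eq_zeroLocus]
          exact (le_sup_right.trans hP : Module.annihilator R M ≤ P)
        have := art_supp _ _ hmem
        change P = _ at this
        rw [this]; exact hr
      · apply Ideal.radical_mono
        refine sup_le ?_ ?_
        · rw [Ideal.span_le]
          rintro _ ⟨i, hi, rfl⟩
          exact hxm i hi
        · apply le_maximalIdeal
          intro ht
          apply hne
          intro z
          have : (1 : R) ∈ Module.annihilator R M := by rw [ht]; trivial
          simpa using Module.mem_annihilator.1 this z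
    let e := ((localCohomology.isoOfSameRadical hrad d).app M).toLinearEquiv
    apply hz
    apply e.injective
    rw [map_zero]
    exact h2 _

lemma cohDim_eq [IsNoetherianRing R] (M : ModuleCat.{0} R) (x : ℕ → R) (n k : ℕ)
    (h : ¬ BD R (LH (Ideal.span (x '' Set.Iio n)) n M) k) :
    sSup {i : ℕ | Nontrivial (LH (Ideal.span (x '' Set.Iio n)) i M)} = n := by
  have hub : n ∈ upperBounds {i : ℕ | Nontrivial (LH (Ideal.span (x '' Set.Iio n)) i M)} := by
    intro i hi
    by_contra hc
    push Not at hc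
    obtain ⟨z, hz⟩ := @exists_ne _ hi (0 : LH (Ideal.span (x '' Set.Iio n)) i M)
    exact hz (lh_vanish x n i M hc z)
  have hmem : n ∈ {i : ℕ | Nontrivial (LH (Ideal.span (x '' Set.Iio n)) i M)} := by
    by_contra hc
    have : Subsingleton (LH (Ideal.span (x '' Set.Iio n)) n M) := not_nontrivial_iff_subsingleton.1 hc
    have h0 : BD R (LH (Ideal.span (x '' Set.Iio n)) n M) 0 :=
      BD_zero.2 fun z => Subsingleton.elim _ _
    exact h fun p hp => absurd (h0 p hp) (by simp)
  exact le_antisymm (csSup_le ⟨n, hmem⟩ hub) (le_csSup ⟨n, hub⟩ hmem)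

lemma not_art [IsLocalRing R] (N : Type) [AddCommGroup N] [Module R N] (k : ℕ) (hk : 0 < k)
    (h : ¬ BD R N k) : ¬ IsArtinian R N := by
  intro ha
  apply h
  intro p hp
  rw [coheight_max p (art_supp N p hp)]
  exact_mod_cast hk

end
end LCAux

/-- Let `(R, m)` be a commutative noetherian local ring, `M` a non-zero
finitely generated `R`-module of Krull dimension `d`, `x₁, ..., x_d` a system of parameters of
`M` (elements of `m` with `M/(x₁,...,x_d)M` of finite length), `n ≤ d`, and
`a = (x₁, ..., xₙ)`.  Then `dim_R(H^{cd(a,M)}_a(M)) = d − n`; in particular, if `n < d` then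
`H^{cd(a,M)}_a(M)` is not artinian. -/
theorem statement18 {R : Type} [CommRing R] [IsNoetherianRing R] [IsLocalRing R]
    (M : ModuleCat R) [Module.Finite R M] [Nontrivial M]
    (d : ℕ) (hd : moduleDim R M = (d : WithBot ℕ∞))
    (x : Fin d → R) (hxm : ∀ i, x i ∈ IsLocalRing.maximalIdeal R)
    (hsop : IsFiniteLength R
      (M ⧸ (Ideal.span (Set.range x) • (⊤ : Submodule R M))))
    (n : ℕ) (hnd : n ≤ d)
    (a : Ideal R) (ha : a = Ideal.span (Set.range fun i : Fin n => x (Fin.castLE hnd i))) :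
    moduleDim R ((localCohomology a (cohDim a M)).obj M) = ((d - n : ℕ) : WithBot ℕ∞) ∧
      (n < d → ¬ IsArtinian R ((localCohomology a (cohDim a M)).obj M)) := by
  let x' : ℕ → R := fun k => if h : k < d then x ⟨k, h⟩ else 0
  have hx' : ∀ (k : ℕ) (h : k < d), x' k = x ⟨k, h⟩ := fun k h => dif_pos h
  have h1 : Set.range x = x' '' Set.Iio d := by
    ext y
    constructor
    · rintro ⟨i, rfl⟩
      exact ⟨i, i.2, hx' i i.2⟩
    · rintro ⟨k, hk, rfl⟩
      exact ⟨⟨k, hk⟩, (hx' k hk).symm⟩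
  have h2 : a = Ideal.span (x' '' Set.Iio n) := by
    rw [ha]
    congr 1
    ext y
    constructor
    · rintro ⟨i, rfl⟩
      exact ⟨i, i.2, hx' i (lt_of_lt_of_le i.2 hnd)⟩
    · rintro ⟨k, hk, rfl⟩
      exact ⟨⟨k, hk⟩, (hx' k (lt_of_lt_of_le hk hnd)).symm⟩
  rw [h1] at hsop
  obtain ⟨hB, hnB⟩ := LCAux.main M d hd x' (fun i hi => by rw [hx' i hi]; exact hxm _) hsop n hnd
  have hc : cohDim a M = n := by
    rw [h2]
    exact LCAux.cohDim_eq M x' n _ hnB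
  rw [hc, h2]
  exact ⟨LCAux.krullDim_eq _ _ hB hnB, fun hlt => LCAux.not_art _ _ (Nat.sub_pos_of_lt hlt) hnB⟩
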